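/- arXiv:2401.08377 — 2 statements merged into one kernel-verified Lean document; each statement's English description precedes it below -/
import Mathlib

section
/- For every open MDP 𝒜 and every entrance i of 𝒜: A^𝒜(i) = A^{D(A^𝒜)}(i), where A^𝒜 denotes the family (A^𝒜(j))_{j∈I} of achievable sets of 𝒜 and D(A^𝒜) is its shortcut oMDP; that is, Pareto-optimal schedulers suffice: the achievable sets of 𝒜 equal the achievable sets of the shortcut oMDP built from the vertices of the achievable sets of 𝒜. -/
open scoped Classical ENNReal

namespace SD

/-- A Markov decision process with finite sets of states and actions: a partial
transition function assigning to a state and an action a probability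
distribution over states. -/
structure MDP (S A : Type) : Type where
  P : S → A → Option (S → ℝ)

namespace MDP

variable {S A : Type} [Fintype S] [Fintype A]

/-- All defined transitions are genuine probability distributions. -/
def Proper (M : MDP S A) : Prop :=
  ∀ s a d, M.P s a = some d → (∀ s', 0 ≤ d s') ∧ ∑ s', d s' = 1

/-- The action `a` is enabled in `s`. -/
def enabled (M : MDP S A) (s : S) (a : A) : Prop := M.P s a ≠ none

/-- A state is terminal if no action is enabled in it. -/
def terminal (M : MDP S A) (s : S) : Prop := ∀ a, M.P s a = none

/-- Transition probabilities. -/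
noncomputable def prob (M : MDP S A) (s : S) (a : A) (s' : S) : ℝ :=
  (M.P s a).elim 0 fun d => d s'

end MDP

/-- A finite path of an MDP: a start state with a list of (action, next state) steps. -/
structure FinPath (S A : Type) : Type where
  start : S
  steps : List (A × S)

namespace FinPath

/-- The last state of a finite path. -/
def last {S A : Type} (π : FinPath S A) : S := (π.steps.map Prod.snd).getLastD π.start

/-- Extending a finite path by one step. -/
def snoc {S A : Type} (π : FinPath S A) (a : A) (s : S) : FinPath S A :=
  ⟨π.start, π.steps ++ [(a, s)]⟩

end FinPath

namespace MDP

variable {S A : Type} [Fintype S] [Fintype A]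

/-- Consistency of a sequence of steps with the transitions, from a given state. -/
def ConsistentFrom (M : MDP S A) : S → List (A × S) → Prop
  | _, [] => True
  | s, (a, s') :: l => M.prob s a s' ≠ 0 ∧ ConsistentFrom M s' l

/-- A finite path is consistent if every step has nonzero probability. -/
def Consistent (M : MDP S A) (π : FinPath S A) : Prop := M.ConsistentFrom π.start π.steps

end MDP

/-- A (history-dependent, stochastic) scheduler, given by its raw weights. -/
abbrev Sched (S A : Type) : Type := FinPath S A → A → ℝ

namespace MDP

variable {S A : Type} [Fintype S] [Fintype A]

/-- `σ` is a scheduler for `M`: it assigns to every (consistent) finite path a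
probability distribution over the actions enabled in its last state. -/
def IsSched (M : MDP S A) (σ : Sched S A) : Prop :=
  ∀ π : FinPath S A, M.Consistent π →
    (∀ a, 0 ≤ σ π a) ∧ (∀ a, σ π a ≠ 0 → M.enabled π.last a) ∧
      (¬M.terminal π.last → ∑ a, σ π a = 1)

end MDP

/-- Memoryless schedulers depend only on the last state of a path. -/
def Memoryless {S A : Type} (σ : Sched S A) : Prop :=
  ∀ π π' : FinPath S A, π.last = π'.last → σ π = σ π'

/-- Deterministic schedulers choose Dirac distributions. -/
def Deterministic {S A : Type} (σ : Sched S A) : Prop := ∀ π a, σ π a = 0 ∨ σ π a = 1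

/-- Deterministic memoryless (DM) schedulers. -/
def DM {S A : Type} (σ : Sched S A) : Prop := Memoryless σ ∧ Deterministic σ

namespace MDP

variable {S A : Type} [Fintype S] [Fintype A]

/-- Probability of visiting `T` within `n` steps (terminal states made absorbing),
starting from the history `π`, under the scheduler `σ`. -/
noncomputable def reachN (M : MDP S A) (σ : Sched S A) (T : Set S) :
    ℕ → FinPath S A → ℝ
  | 0, π => if π.last ∈ T then 1 else 0
  | n + 1, π =>
      if π.last ∈ T then 1
      else ∑ a : A, σ π a * ∑ s' : S, M.prob π.last a s' * reachN M σ T n (π.snoc a s')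

/-- `Pr^{M,σ}(s ⊨ ◇T)`: the probability, under the measure on infinite paths induced
by `σ` from `s` (terminal states made absorbing), of the paths that visit `T`; it is
the supremum of the bounded-horizon reachability probabilities. -/
noncomputable def Pr (M : MDP S A) (σ : Sched S A) (s : S) (T : Set S) : ℝ :=
  ⨆ n : ℕ, M.reachN σ T n ⟨s, []⟩

end MDP

/-- An open MDP: an MDP together with (totally ordered, given as lists) sets of
rightward/leftward entrances and exits. -/
structure OMDP (S A : Type) : Type where
  M : MDP S A
  Ir : List S
  Il : List S
  Or : List S
  Ol : List S

namespace OMDP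

variable {S A : Type}

/-- The entrances `I = I_r ∪ I_l`. -/
def entr (𝒜 : OMDP S A) : List S := 𝒜.Ir ++ 𝒜.Il

/-- The exits `O = O_r ∪ O_l`. -/
def exit (𝒜 : OMDP S A) : List S := 𝒜.Or ++ 𝒜.Ol

/-- The index type of exits. -/
abbrev ExitIdx (𝒜 : OMDP S A) : Type := {s : S // s ∈ 𝒜.exit}

/-- The index type of entrances. -/
abbrev EntrIdx (𝒜 : OMDP S A) : Type := {s : S // s ∈ 𝒜.entr}

variable [Fintype S] [Fintype A]

/-- Well-formedness of an open MDP: the transitions are probability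
distributions, the open ends are pairwise disjoint (each without duplicates),
and the exits are exactly the terminal states. -/
def WF (𝒜 : OMDP S A) : Prop :=
  𝒜.M.Proper ∧ (𝒜.Ir ++ 𝒜.Il ++ 𝒜.Or ++ 𝒜.Ol).Nodup ∧
    ∀ s : S, s ∈ 𝒜.exit ↔ 𝒜.M.terminal s

/-- `Pr^{𝒜,σ}(i ⊨ ◇O) ∈ ℝ^O`: the vector of reachability probabilities to each exit. -/
noncomputable def prVec (𝒜 : OMDP S A) (σ : Sched S A) (i : S) : 𝒜.ExitIdx → ℝ :=
  fun j => 𝒜.M.Pr σ i {j.1}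

/-- The set `A^𝒜(i)` of achievable points from `i`. -/
def achievable (𝒜 : OMDP S A) (i : S) : Set (𝒜.ExitIdx → ℝ) :=
  {p | ∃ σ : Sched S A, 𝒜.M.IsSched σ ∧ p ≤ 𝒜.prVec σ i}

/-- The set `A^{𝒜,Σ}(i)` of points achievable from `i` by schedulers in the class `C`. -/
def achievableBy (𝒜 : OMDP S A) (i : S) (C : Sched S A → Prop) : Set (𝒜.ExitIdx → ℝ) :=
  {p | ∃ σ : Sched S A, 𝒜.M.IsSched σ ∧ C σ ∧ p ≤ 𝒜.prVec σ i}

/-- The Pareto curve `𝒮(𝒜, i)`: achievable points not strictly dominated by an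
achievable point. -/
def pareto (𝒜 : OMDP S A) (i : S) : Set (𝒜.ExitIdx → ℝ) :=
  {p | p ∈ 𝒜.achievable i ∧ ∀ q ∈ 𝒜.achievable i, p ≤ q → q = p}

end OMDP

/-- Downward closure. -/
def dw {ι : Type} (X : Set (ι → ℝ)) : Set (ι → ℝ) := {p | ∃ q ∈ X, p ≤ q}

/-- Downward convex closure. -/
def dwConv {ι : Type} (X : Set (ι → ℝ)) : Set (ι → ℝ) := dw (convexHull ℝ X)

/-- Subdistributions on `ι`: nonnegative points with coordinate sum at most 1. -/
def Subdist {ι : Type} [Fintype ι] (p : ι → ℝ) : Prop :=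
  (∀ j, 0 ≤ p j) ∧ ∑ j, p j ≤ 1

end SD

namespace SD

namespace OMDP

variable {S A : Type} [Fintype S] [Fintype A]

/-- The actions of a shortcut oMDP for the family `B`: the union of the `B i`. -/
abbrev ShortAct (𝒜 : OMDP S A) (B : 𝒜.EntrIdx → Finset (𝒜.ExitIdx → ℝ)) : Type :=
  {p : 𝒜.ExitIdx → ℝ // ∃ i, p ∈ B i}

noncomputable instance instFintypeShortAct (𝒜 : OMDP S A)
    (B : 𝒜.EntrIdx → Finset (𝒜.ExitIdx → ℝ)) : Fintype (ShortAct 𝒜 B) := by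
  have h : {p : 𝒜.ExitIdx → ℝ | ∃ i, p ∈ B i}.Finite := by
    have he : {p : 𝒜.ExitIdx → ℝ | ∃ i, p ∈ B i} =
        ⋃ i, ((B i : Finset (𝒜.ExitIdx → ℝ)) : Set (𝒜.ExitIdx → ℝ)) := by
      ext p; simp
    rw [he]
    exact Set.finite_iUnion fun i => (B i).finite_toSet
  exact h.fintype

/-- The shortcut oMDP `D(B)` of a family `B = (B_i)_{i ∈ I}` of finite sets of
subdistributions on the exits: states are the entrances and exits of `𝒜`
together with a fresh sink `⋆` (encoded by `Option S`, with `⋆ = none`), actions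
are the points in the `B_i`, and from entrance `i` the action `p ∈ B_i` moves to
exit `o` with probability `p(o)` and to `⋆` with the remaining probability
`1 - Σ_o p(o)`. -/
noncomputable def shortcut (𝒜 : OMDP S A) (B : 𝒜.EntrIdx → Finset (𝒜.ExitIdx → ℝ)) :
    OMDP (Option S) (ShortAct 𝒜 B) where
  M := ⟨fun t a =>
    match t with
    | none => none
    | some s =>
        if _h : ∃ hs : s ∈ 𝒜.entr, a.1 ∈ B ⟨s, hs⟩ then
          some fun t' =>
            match t' with
            | none => 1 - ∑ j : 𝒜.ExitIdx, a.1 j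
            | some s' => ∑ j : 𝒜.ExitIdx, if j.1 = s' then a.1 j else 0
        else none⟩
  Ir := 𝒜.Ir.map some
  Il := 𝒜.Il.map some
  Or := 𝒜.Or.map some
  Ol := 𝒜.Ol.map some

end OMDP

/-- Transporting points in `ℝ^{O_𝒴}` to points in `ℝ^{O_𝒳}` along a map of exits. -/
def pullExit {S₁ A₁ S₂ A₂ : Type} (𝒳 : OMDP S₁ A₁) (𝒴 : OMDP S₂ A₂) (f : S₁ → S₂)
    (hf : ∀ s ∈ 𝒳.exit, f s ∈ 𝒴.exit) (p : 𝒴.ExitIdx → ℝ) : 𝒳.ExitIdx → ℝ :=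
  fun j => p ⟨f j.1, hf j.1 j.2⟩

end SD

namespace SD

namespace MDP

variable {S A : Type} [Fintype A]

theorem exists_isSched (M : MDP S A) : ∃ σ : Sched S A, M.IsSched σ := by
  refine ⟨fun π => if h : ∃ a, M.enabled π.last a then Pi.single h.choose 1 else 0, ?_⟩
  intro π _
  by_cases h : ∃ a, M.enabled π.last a
  · simp only [dif_pos h]
    refine ⟨fun a => ?_, fun a ha => ?_, fun _ => by simp⟩
    · by_cases hc : a = h.choose <;> simp [hc]
    · have hc : a = h.choose := by
        by_contra hc
        simp [hc] at ha
      exact hc ▸ h.choose_spec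
  · simp only [dif_neg h]
    refine ⟨fun a => le_rfl, fun a ha => (ha rfl).elim, fun ht => (ht fun a => ?_).elim⟩
    by_contra ha
    exact h ⟨a, ha⟩

/-- A distribution on the actions enabled in `s` extends to a scheduler that uses it on all
paths ending in `s`. -/
theorem exists_isSched_eq (M : MDP S A) (s : S) (w : A → ℝ) (hw0 : ∀ a, 0 ≤ w a)
    (hwe : ∀ a, w a ≠ 0 → M.enabled s a) (hw1 : ∑ a, w a = 1) :
    ∃ σ : Sched S A, M.IsSched σ ∧ ∀ π : FinPath S A, π.last = s → σ π = w := by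
  obtain ⟨τ, hτ⟩ := M.exists_isSched
  refine ⟨fun π => if π.last = s then w else τ π, fun π hc => ?_, fun π hπ => if_pos hπ⟩
  by_cases hs : π.last = s
  · simp only [hs, if_true]
    exact ⟨hw0, hwe, fun _ => hw1⟩
  · simp only [hs, if_false]
    exact hτ π hc

variable [Fintype S]

theorem reachN_eq_zero_of_terminal {M : MDP S A} {σ : Sched S A} (hσ : M.IsSched σ)
    {T : Set S} {π : FinPath S A} (hc : M.Consistent π) (ht : M.terminal π.last)
    (hT : π.last ∉ T) (n : ℕ) : M.reachN σ T n π = 0 := by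
  cases n with
  | zero => simp [reachN, hT]
  | succ n =>
    rw [reachN, if_neg hT]
    refine Finset.sum_eq_zero fun a _ => ?_
    by_cases ha : σ π a = 0
    · simp [ha]
    · exact absurd (ht a) ((hσ π hc).2.1 a ha)

end MDP

namespace OMDP

variable {S A : Type}

theorem WF.notMem_exit [Fintype S] {𝒜 : OMDP S A} (h : 𝒜.WF) {s : S} (hs : s ∈ 𝒜.entr) : s ∉ 𝒜.exit := by
  have h' := h.2.1
  rw [List.append_assoc, List.nodup_append] at h'
  exact fun he => h'.2.2 s hs s he rfl

variable {𝒜 : OMDP S A} {V : 𝒜.EntrIdx → Finset (𝒜.ExitIdx → ℝ)}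

theorem shortcut_enabled_iff (i : 𝒜.EntrIdx) (a : ShortAct 𝒜 V) :
    (𝒜.shortcut V).M.enabled (some i.1) a ↔ a.1 ∈ V i := by
  have hi := i.2
  simp [MDP.enabled, shortcut, hi]

theorem shortcut_terminal_none : (𝒜.shortcut V).M.terminal none := fun _ => rfl

theorem shortcut_terminal_some {s : S} (hs : s ∉ 𝒜.entr) :
    (𝒜.shortcut V).M.terminal (some s) := by
  intro a
  simp [shortcut, hs]

theorem shortcut_prob_exit {i : 𝒜.EntrIdx} {a : ShortAct 𝒜 V} (ha : a.1 ∈ V i)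
    (o : 𝒜.ExitIdx) : (𝒜.shortcut V).M.prob (some i.1) a (some o.1) = a.1 o := by
  have hi : ∃ hs : i.1 ∈ 𝒜.entr, a.1 ∈ V ⟨i.1, hs⟩ := ⟨i.2, ha⟩
  simp [MDP.prob, shortcut, hi, Subtype.coe_inj]

theorem shortcut_prob_of_notMem_exit {i : 𝒜.EntrIdx} {a : ShortAct 𝒜 V} (ha : a.1 ∈ V i)
    {s : S} (hs : s ∉ 𝒜.exit) : (𝒜.shortcut V).M.prob (some i.1) a (some s) = 0 := by
  have hi : ∃ hs : i.1 ∈ 𝒜.entr, a.1 ∈ V ⟨i.1, hs⟩ := ⟨i.2, ha⟩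
  simp only [MDP.prob, shortcut, dif_pos hi, Option.elim_some]
  refine Finset.sum_eq_zero fun j _ => if_neg fun h => hs ?_
  rw [← h]
  exact j.2

variable [Fintype S]

theorem shortcut_reachN_succ (hWF : 𝒜.WF) {σ : Sched (Option S) (ShortAct 𝒜 V)}
    (hσ : (𝒜.shortcut V).M.IsSched σ) (i : 𝒜.EntrIdx) (o : 𝒜.ExitIdx) (n : ℕ) :
    (𝒜.shortcut V).M.reachN σ {some o.1} (n + 1) ⟨some i.1, []⟩ =
      ∑ a, σ ⟨some i.1, []⟩ a * a.1 o := by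
  have hio : i.1 ≠ o.1 := fun h => hWF.notMem_exit i.2 (h ▸ o.2)
  rw [MDP.reachN, if_neg (by simpa [FinPath.last] using hio)]
  refine Finset.sum_congr rfl fun a _ => ?_
  by_cases h0 : σ ⟨some i.1, []⟩ a = 0
  · simp [h0]
  have ha : a.1 ∈ V i :=
    (shortcut_enabled_iff i a).1 ((hσ ⟨some i.1, []⟩ trivial).2.1 a h0)
  congr 1
  change ∑ t, (𝒜.shortcut V).M.prob (some i.1) a t *
    (𝒜.shortcut V).M.reachN σ {some o.1} n ⟨some i.1, [(a, t)]⟩ = a.1 o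
  rw [Finset.sum_eq_single (some o.1)]
  · rw [shortcut_prob_exit ha]
    cases n <;> simp [MDP.reachN, FinPath.last]
  · intro t _ hto
    by_cases hp : (𝒜.shortcut V).M.prob (some i.1) a t = 0
    · simp [hp]
    have ht : (𝒜.shortcut V).M.terminal t := by
      cases t with
      | none => exact shortcut_terminal_none
      | some s =>
        refine shortcut_terminal_some fun hs => hp ?_
        exact shortcut_prob_of_notMem_exit ha (hWF.notMem_exit hs)
    have hc : (𝒜.shortcut V).M.Consistent ⟨some i.1, [(a, t)]⟩ := ⟨hp, trivial⟩
    rw [MDP.reachN_eq_zero_of_terminal hσ hc ht hto, mul_zero]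
  · simp

/-- In a shortcut oMDP, the value of a scheduler at an entrance is the average of the
chosen actions. -/
theorem shortcut_Pr (hWF : 𝒜.WF) (hV : ∀ k, ∀ p ∈ V k, Subdist p)
    {σ : Sched (Option S) (ShortAct 𝒜 V)} (hσ : (𝒜.shortcut V).M.IsSched σ)
    (i : 𝒜.EntrIdx) (o : 𝒜.ExitIdx) :
    (𝒜.shortcut V).M.Pr σ (some i.1) {some o.1} = ∑ a, σ ⟨some i.1, []⟩ a * a.1 o := by
  have hnonneg : 0 ≤ ∑ a, σ ⟨some i.1, []⟩ a * a.1 o := by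
    refine Finset.sum_nonneg fun a _ => mul_nonneg ((hσ ⟨some i.1, []⟩ trivial).1 a) ?_
    obtain ⟨k, hk⟩ := a.2
    exact (hV k _ hk).1 o
  have hle : ∀ n, (𝒜.shortcut V).M.reachN σ {some o.1} n ⟨some i.1, []⟩ ≤
      ∑ a, σ ⟨some i.1, []⟩ a * a.1 o := by
    intro n
    cases n with
    | zero =>
      have hio : i.1 ≠ o.1 := fun h => hWF.notMem_exit i.2 (h ▸ o.2)
      simpa [MDP.reachN, FinPath.last, hio] using hnonneg
    | succ n => exact (shortcut_reachN_succ hWF hσ i o n).le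
  refine le_antisymm (ciSup_le hle) ?_
  rw [← shortcut_reachN_succ hWF hσ i o 0]
  exact le_ciSup ⟨_, Set.forall_mem_range.2 hle⟩ 1

theorem sum_shortAct (i : 𝒜.EntrIdx) {E : Type} [AddCommMonoid E]
    (f : (𝒜.ExitIdx → ℝ) → E) (hf : ∀ p ∉ V i, f p = 0) :
    ∑ a : ShortAct 𝒜 V, f a.1 = ∑ p ∈ V i, f p := by
  symm
  refine Finset.sum_bij_ne_zero (fun p hp _ => ⟨p, i, hp⟩) (fun _ _ _ => Finset.mem_univ _)
    (fun _ _ _ _ _ _ h => congrArg Subtype.val h) (fun a _ ha => ?_) (fun _ _ _ => rfl)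
  have hm : a.1 ∈ V i := by
    by_contra h
    exact ha (hf _ h)
  exact ⟨a.1, hm, ha, rfl⟩

/-- The vectors of exit probabilities of a shortcut oMDP at an entrance are the convex
combinations of the actions available there. -/
theorem exists_sched_shortcut_iff (hWF : 𝒜.WF) (hV : ∀ k, ∀ p ∈ V k, Subdist p)
    (i : 𝒜.EntrIdx) (hi : (V i).Nonempty) (q : 𝒜.ExitIdx → ℝ) :
    (∃ σ, (𝒜.shortcut V).M.IsSched σ ∧
      ∀ o : 𝒜.ExitIdx, (𝒜.shortcut V).M.Pr σ (some i.1) {some o.1} = q o) ↔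
      q ∈ convexHull ℝ (V i : Set (𝒜.ExitIdx → ℝ)) := by
  rw [Finset.mem_convexHull']
  constructor
  · rintro ⟨σ, hσ, hq⟩
    obtain ⟨h0, he, h1⟩ := hσ ⟨some i.1, []⟩ trivial
    let w : (𝒜.ExitIdx → ℝ) → ℝ := fun p =>
      if h : ∃ k, p ∈ V k then σ ⟨some i.1, []⟩ ⟨p, h⟩ else 0
    have hw : ∀ a : ShortAct 𝒜 V, w a.1 = σ ⟨some i.1, []⟩ a := fun a => dif_pos a.2
    have hw0 : ∀ p ∉ V i, w p = 0 := by
      intro p hp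
      by_cases h : ∃ k, p ∈ V k
      · by_contra hne
        exact hp ((shortcut_enabled_iff i ⟨p, h⟩).1 (he ⟨p, h⟩ (hw ⟨p, h⟩ ▸ hne)))
      · exact dif_neg h
    have hpr : ∀ o : 𝒜.ExitIdx, q o = ∑ p ∈ V i, w p * p o := by
      intro o
      rw [← hq, shortcut_Pr hWF hV hσ, ← sum_shortAct i (fun p => w p * p o)]
      · simp only [hw]
      · intro p hp
        simp [hw0 p hp]
    have hnt : ¬(𝒜.shortcut V).M.terminal (some i.1) := by
      obtain ⟨p, hp⟩ := hi
      exact fun ht => (shortcut_enabled_iff i ⟨p, i, hp⟩).2 hp (ht _)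
    refine ⟨w, fun p hp => (hw ⟨p, i, hp⟩).symm ▸ h0 _, ?_, funext fun o => ?_⟩
    · rw [← sum_shortAct i w hw0, ← h1 hnt]
      simp only [hw]
    · rw [hpr, Finset.sum_apply]
      rfl
  · rintro ⟨w, hw0, hw1, hq⟩
    let w' : (𝒜.ExitIdx → ℝ) → ℝ := fun p => if p ∈ V i then w p else 0
    have hw' : ∀ p ∈ V i, w' p = w p := fun p hp => if_pos hp
    have hz : ∀ p ∉ V i, w' p = 0 := fun p hp => if_neg hp
    obtain ⟨σ, hσ, hσw⟩ := (𝒜.shortcut V).M.exists_isSched_eq (some i.1) (fun a => w' a.1)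
      (fun a => by
        by_cases h : a.1 ∈ V i
        · exact (hw' _ h).symm ▸ hw0 _ h
        · exact (hz _ h).ge)
      (fun a ha => (shortcut_enabled_iff i a).2 (by
        by_contra h
        exact ha (hz _ h)))
      (by rw [sum_shortAct i w' hz, Finset.sum_congr rfl hw', hw1])
    refine ⟨σ, hσ, fun o => ?_⟩
    rw [shortcut_Pr hWF hV hσ, hσw _ rfl, sum_shortAct i (fun p => w' p * p o), ← hq,
      Finset.sum_apply]
    · exact Finset.sum_congr rfl fun p hp => by simp [hw' p hp]
    · intro p hp
      simp [hz p hp]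

end OMDP

end SD

open SD in
/-- For every open MDP `𝒜` and every entrance `i` of `𝒜`:
`A^𝒜(i) = A^{D(A^𝒜)}(i)`, where `D(A^𝒜)` is the shortcut oMDP built from the
vertices `V` of the (convex, downward-closed, finitely generated) achievable
sets of `𝒜` (which are families of subdistributions), and the achievable sets
of the shortcut oMDP are transported along the canonical identification
`s ↦ some s` of the exits: Pareto-optimal schedulers suffice. -/
theorem statement_2 {S A : Type} [Fintype S] [Fintype A]
    (𝒜 : OMDP S A) (hWF : 𝒜.WF)
    (V : 𝒜.EntrIdx → Finset (𝒜.ExitIdx → ℝ))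
    (hV : ∀ k, ∀ p ∈ V k, Subdist p)
    (hgen : ∀ k : 𝒜.EntrIdx,
      𝒜.achievable k.1 = dwConv ((V k : Finset (𝒜.ExitIdx → ℝ)) : Set (𝒜.ExitIdx → ℝ)))
    (hmem : ∀ s ∈ 𝒜.exit, (some s : Option S) ∈ (𝒜.shortcut V).exit)
    (i : 𝒜.EntrIdx) :
    𝒜.achievable i.1 =
      pullExit 𝒜 (𝒜.shortcut V) some hmem '' (𝒜.shortcut V).achievable (some i.1) := by
  have hne : (V i).Nonempty := by
    obtain ⟨σ, hσ⟩ := 𝒜.M.exists_isSched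
    have hmem' : 𝒜.prVec σ i.1 ∈ 𝒜.achievable i.1 := ⟨σ, hσ, le_rfl⟩
    rw [hgen i] at hmem'
    obtain ⟨q, hq, _⟩ := hmem'
    exact Finset.coe_nonempty.1 (convexHull_nonempty_iff.1 ⟨q, hq⟩)
  rw [hgen i]
  ext p
  constructor
  · rintro ⟨q, hq, hpq⟩
    obtain ⟨σ, hσ, hval⟩ := (OMDP.exists_sched_shortcut_iff hWF hV i hne q).2 hq
    let f : 𝒜.ExitIdx → (𝒜.shortcut V).ExitIdx := fun j => ⟨some j.1, hmem j.1 j.2⟩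
    have hf : Function.Injective f := fun j k h =>
      Subtype.ext (Option.some_injective _ (congrArg Subtype.val h))
    refine ⟨Function.extend f p ((𝒜.shortcut V).prVec σ (some i.1)), ⟨σ, hσ, fun j => ?_⟩,
      funext fun j => hf.extend_apply _ _ j⟩
    by_cases hj : ∃ o, f o = j
    · obtain ⟨o, rfl⟩ := hj
      rw [hf.extend_apply]
      exact (hpq o).trans (hval o).ge
    · rw [Function.extend_apply' _ _ _ hj]
  · rintro ⟨r, ⟨σ, hσ, hr⟩, rfl⟩
    exact ⟨_, (OMDP.exists_sched_shortcut_iff hWF hV i hne _).1 ⟨σ, hσ, fun _ => rfl⟩,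
      fun j => hr ⟨some j.1, hmem j.1 j.2⟩⟩
end

section
/- Let 𝒜, ℬ be open MDPs whose sequential composition 𝒜⨟ℬ is well-defined (type-matching arities), and let (L^𝒜,U^𝒜) and (L^ℬ,U^ℬ) be sound approximations of 𝒜 and ℬ respectively. Then the pair of families of achievable sets of D(L^𝒜)⨟D(L^ℬ) and of D(U^𝒜)⨟D(U^ℬ) is a sound approximation of 𝒜⨟ℬ; that is, for every entrance i of 𝒜⨟ℬ: A^{D(L^𝒜)⨟D(L^ℬ)}(i) ⊆ A^{𝒜⨟ℬ}(i) ⊆ A^{D(U^𝒜)⨟D(U^ℬ)}(i). -/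
open scoped Classical ENNReal

namespace SD

namespace OMDP

variable {S₁ A₁ S₂ A₂ : Type}

/-- The sequential composition `𝒜 ⨟ ℬ` of type-matching open MDPs: the disjoint
union of the two oMDPs in which the `i`-th rightward exit of `𝒜` moves with
probability 1 to the `i`-th rightward entrance of `ℬ` and the `i`-th leftward
exit of `ℬ` moves with probability 1 to the `i`-th leftward entrance of `𝒜`;
its entrances are `(I_r^𝒜, I_l^ℬ)` and its exits are `(O_r^ℬ, O_l^𝒜)`. -/
noncomputable def seqComp (𝒜 : OMDP S₁ A₁) (ℬ : OMDP S₂ A₂)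
    (h₁ : 𝒜.Or.length = ℬ.Ir.length) (h₂ : ℬ.Ol.length = 𝒜.Il.length) :
    OMDP (S₁ ⊕ S₂) (A₁ ⊕ A₂) where
  M := ⟨fun t a =>
    match t with
    | Sum.inl s =>
        if h : ∃ k : Fin 𝒜.Or.length, 𝒜.Or.get k = s then
          some fun t' => if t' = Sum.inr (ℬ.Ir.get (Fin.cast h₁ h.choose)) then 1 else 0
        else
          match a with
          | Sum.inl a => (𝒜.M.P s a).map fun d => Sum.elim d fun _ => 0
          | Sum.inr _ => none
    | Sum.inr s =>
        if h : ∃ k : Fin ℬ.Ol.length, ℬ.Ol.get k = s then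
          some fun t' => if t' = Sum.inl (𝒜.Il.get (Fin.cast h₂ h.choose)) then 1 else 0
        else
          match a with
          | Sum.inr a => (ℬ.M.P s a).map fun d => Sum.elim (fun _ => 0) d
          | Sum.inl _ => none⟩
  Ir := 𝒜.Ir.map Sum.inl
  Il := ℬ.Il.map Sum.inr
  Or := ℬ.Or.map Sum.inr
  Ol := 𝒜.Ol.map Sum.inl

/-- The sequential composition `σ₁ ⨟ σ₂` of memoryless schedulers on `𝒜` and `ℬ`:
it behaves like `σ₁` on the states of `𝒜` and like `σ₂` on the states of `ℬ`
(on the connecting exits, where all actions induce the same probability-1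
transition, it plays uniformly). -/
noncomputable def schedSeqComp [Fintype A₁] [Fintype A₂] (𝒜 : OMDP S₁ A₁) (ℬ : OMDP S₂ A₂)
    (σ₁ : Sched S₁ A₁) (σ₂ : Sched S₂ A₂) : Sched (S₁ ⊕ S₂) (A₁ ⊕ A₂) := fun π a =>
  match π.last, a with
  | Sum.inl s, a =>
      if s ∈ 𝒜.Or then ((Fintype.card (A₁ ⊕ A₂) : ℝ))⁻¹
      else
        match a with
        | Sum.inl a => σ₁ ⟨s, []⟩ a
        | Sum.inr _ => 0
  | Sum.inr s, a =>
      if s ∈ ℬ.Ol then ((Fintype.card (A₁ ⊕ A₂) : ℝ))⁻¹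
      else
        match a with
        | Sum.inr a => σ₂ ⟨s, []⟩ a
        | Sum.inl _ => 0

/-- The restriction of a (memoryless) scheduler on `𝒜 ⨟ ℬ` to the states of `𝒜`. -/
noncomputable def restrictL [Fintype S₁] [Fintype A₁] (𝒜 : OMDP S₁ A₁)
    (τ : Sched (S₁ ⊕ S₂) (A₁ ⊕ A₂)) : Sched S₁ A₁ := fun π a =>
  if 𝒜.M.terminal π.last then 0 else τ ⟨Sum.inl π.last, []⟩ (Sum.inl a)

/-- The restriction of a (memoryless) scheduler on `𝒜 ⨟ ℬ` to the states of `ℬ`. -/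
noncomputable def restrictR [Fintype S₂] [Fintype A₂] (ℬ : OMDP S₂ A₂)
    (τ : Sched (S₁ ⊕ S₂) (A₁ ⊕ A₂)) : Sched S₂ A₂ := fun π a =>
  if ℬ.M.terminal π.last then 0 else τ ⟨Sum.inr π.last, []⟩ (Sum.inr a)

end OMDP

end SD

set_option linter.unusedSectionVars false

namespace SD

namespace FinPath

variable {S A : Type}

@[simp] lemma last_snoc (π : FinPath S A) (a : A) (s : S) : (π.snoc a s).last = s := by
  simp [last, snoc, List.getLastD_eq_getLast?]

end FinPath

namespace MDP

variable {S A : Type} [Fintype S] [Fintype A] {M : MDP S A}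

lemma Proper.prob_nonneg (hM : M.Proper) (s : S) (a : A) (s' : S) : 0 ≤ M.prob s a s' := by
  unfold prob
  cases h : M.P s a with
  | none => simp
  | some d => exact (hM s a d h).1 s'

lemma Proper.sum_prob (hM : M.Proper) {s : S} {a : A} (h : M.enabled s a) :
    ∑ s', M.prob s a s' = 1 := by
  unfold prob enabled at *
  cases h' : M.P s a with
  | none => exact absurd h' h
  | some d => exact (hM s a d h').2

lemma prob_eq_zero {s : S} {a : A} (h : ¬ M.enabled s a) (s' : S) : M.prob s a s' = 0 := by
  have : M.P s a = none := by simpa [enabled] using h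
  simp [prob, this]

lemma Proper.sum_prob_le (hM : M.Proper) (s : S) (a : A) : ∑ s', M.prob s a s' ≤ 1 := by
  by_cases h : M.enabled s a
  · exact (hM.sum_prob h).le
  · simp [prob_eq_zero h]

lemma terminal.not_enabled {s : S} (h : M.terminal s) (a : A) : ¬ M.enabled s a := by
  simp [enabled, h a]

lemma consistent_nil (s : S) : M.Consistent ⟨s, []⟩ := trivial

lemma consistentFrom_append {s : S} {l : List (A × S)} {a : A} {s' : S}
    (h : M.ConsistentFrom s l) (h' : M.prob ((l.map Prod.snd).getLastD s) a s' ≠ 0) :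
    M.ConsistentFrom s (l ++ [(a, s')]) := by
  induction l generalizing s with
  | nil => exact ⟨by simpa using h', trivial⟩
  | cons x l ih =>
    obtain ⟨b, t⟩ := x
    refine ⟨h.1, ih h.2 ?_⟩
    simpa only [List.map_cons, List.getLastD_cons] using h'

lemma Consistent.snoc {π : FinPath S A} (h : M.Consistent π) {a : A} {s' : S}
    (h' : M.prob π.last a s' ≠ 0) : M.Consistent (π.snoc a s') :=
  consistentFrom_append h h'

lemma IsSched.sum_le_one {σ : Sched S A} (hσ : M.IsSched σ) {π : FinPath S A}
    (hπ : M.Consistent π) : ∑ a, σ π a ≤ 1 := by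
  obtain ⟨-, h2, h3⟩ := hσ π hπ
  by_cases ht : M.terminal π.last
  · have : ∀ a, σ π a = 0 := fun a => by
      by_contra h
      exact ht.not_enabled a (h2 a h)
    simp [this]
  · exact (h3 ht).le

/-- The one-step expectation under a scheduler is monotone. -/
lemma IsSched.expect_mono {σ : Sched S A} (hM : M.Proper) (hσ : M.IsSched σ)
    {π : FinPath S A} (hπ : M.Consistent π) {f g : A → S → ℝ}
    (h : ∀ a s', M.Consistent (π.snoc a s') → f a s' ≤ g a s') :
    ∑ a, σ π a * ∑ s', M.prob π.last a s' * f a s' ≤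
      ∑ a, σ π a * ∑ s', M.prob π.last a s' * g a s' := by
  refine Finset.sum_le_sum fun a _ => mul_le_mul_of_nonneg_left ?_ ((hσ π hπ).1 a)
  refine Finset.sum_le_sum fun s' _ => ?_
  by_cases h0 : M.prob π.last a s' = 0
  · simp [h0]
  · exact mul_le_mul_of_nonneg_left (h a s' (hπ.snoc h0)) (hM.prob_nonneg _ _ _)

lemma reachN_nonneg (hM : M.Proper) {σ : Sched S A} (hσ : M.IsSched σ) (T : Set S) (n : ℕ)
    {π : FinPath S A} (hπ : M.Consistent π) : 0 ≤ M.reachN σ T n π := by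
  induction n generalizing π with
  | zero => unfold reachN; split_ifs <;> norm_num
  | succ n ih =>
    unfold reachN
    split_ifs
    · norm_num
    · have := hσ.expect_mono hM hπ (f := fun _ _ => 0)
        (g := fun a s' => M.reachN σ T n (π.snoc a s')) fun a s' h => ih h
      simpa using this

lemma reachN_le_one (hM : M.Proper) {σ : Sched S A} (hσ : M.IsSched σ) (T : Set S) (n : ℕ)
    {π : FinPath S A} (hπ : M.Consistent π) : M.reachN σ T n π ≤ 1 := by
  induction n generalizing π with
  | zero => unfold reachN; split_ifs <;> norm_num
  | succ n ih =>
    unfold reachN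
    split_ifs
    · norm_num
    · have := hσ.expect_mono hM hπ (g := fun _ _ => 1)
        (f := fun a s' => M.reachN σ T n (π.snoc a s')) fun a s' h => ih h
      refine this.trans (le_trans ?_ (hσ.sum_le_one hπ))
      refine Finset.sum_le_sum fun a _ => ?_
      simpa using mul_le_mul_of_nonneg_left (hM.sum_prob_le π.last a) ((hσ π hπ).1 a)

lemma reachN_le_succ (hM : M.Proper) {σ : Sched S A} (hσ : M.IsSched σ) (T : Set S) (n : ℕ)
    {π : FinPath S A} (hπ : M.Consistent π) : M.reachN σ T n π ≤ M.reachN σ T (n + 1) π := by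
  induction n generalizing π with
  | zero =>
    by_cases h : π.last ∈ T
    · simp [reachN, h]
    · have := reachN_nonneg hM hσ T 1 hπ
      simpa [reachN, h] using this
  | succ n ih =>
    by_cases h : π.last ∈ T
    · simp [reachN, h]
    · rw [reachN, reachN, if_neg h, if_neg h]
      exact hσ.expect_mono hM hπ fun a s' h => ih h

lemma tendsto_reachN (hM : M.Proper) {σ : Sched S A} (hσ : M.IsSched σ) (T : Set S) (s : S) :
    Filter.Tendsto (fun n => M.reachN σ T n ⟨s, []⟩) Filter.atTop (nhds (M.Pr σ s T)) := by
  refine tendsto_atTop_ciSup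
    (monotone_nat_of_le_succ fun n => reachN_le_succ hM hσ T n (consistent_nil s)) ⟨1, ?_⟩
  rintro _ ⟨n, rfl⟩
  exact reachN_le_one hM hσ T n (consistent_nil s)

/-- The product of the weights that `σ` gives to the steps of `l`, after the history `π`. -/
def weightFrom (σ : Sched S A) : FinPath S A → List (A × S) → ℝ
  | _, [] => 1
  | π, (a, s) :: l => σ π a * weightFrom σ (π.snoc a s) l

/-- The product of the weights that `σ` gives to the actions along `π`. -/
def weight (σ : Sched S A) (π : FinPath S A) : ℝ := weightFrom σ ⟨π.start, []⟩ π.steps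

lemma weightFrom_append (σ : Sched S A) (π : FinPath S A) (l : List (A × S)) (a : A) (s : S) :
    weightFrom σ π (l ++ [(a, s)]) = weightFrom σ π l * σ ⟨π.start, π.steps ++ l⟩ a := by
  induction l generalizing π with
  | nil => simp [weightFrom]
  | cons x l ih =>
    obtain ⟨b, t⟩ := x
    simp [weightFrom, ih, FinPath.snoc, mul_assoc]

lemma weight_snoc (σ : Sched S A) (π : FinPath S A) (a : A) (s : S) :
    weight σ (π.snoc a s) = weight σ π * σ π a := by
  simp [weight, FinPath.snoc, weightFrom_append]

lemma weightFrom_nonneg {σ : Sched S A} (hσ : M.IsSched σ) {π : FinPath S A}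
    (hπ : M.Consistent π) {l : List (A × S)} (hl : M.ConsistentFrom π.last l) :
    0 ≤ weightFrom σ π l := by
  induction l generalizing π with
  | nil => simp [weightFrom]
  | cons x l ih =>
    obtain ⟨b, t⟩ := x
    exact mul_nonneg ((hσ π hπ).1 b) (ih (hπ.snoc hl.1) (by simpa using hl.2))

lemma weight_nonneg {σ : Sched S A} (hσ : M.IsSched σ) {π : FinPath S A}
    (hπ : M.Consistent π) : 0 ≤ weight σ π :=
  weightFrom_nonneg hσ (consistent_nil _) hπ

/-- The scheduler that behaves like `σ` with probability `x` and like `τ` with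
probability `y`, the choice being made at the start. -/
noncomputable def mix (x y : ℝ) (σ τ : Sched S A) : Sched S A := fun π a =>
  if x * weight σ π + y * weight τ π = 0 then σ π a
  else (x * weight σ π * σ π a + y * weight τ π * τ π a) /
    (x * weight σ π + y * weight τ π)

lemma mix_mul {x y : ℝ} (hx : 0 ≤ x) (hy : 0 ≤ y) {σ τ : Sched S A} (hσ : M.IsSched σ)
    (hτ : M.IsSched τ) {π : FinPath S A} (hπ : M.Consistent π) (a : A) :
    (x * weight σ π + y * weight τ π) * mix x y σ τ π a =
      x * weight σ π * σ π a + y * weight τ π * τ π a := by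
  unfold mix
  have h1 := mul_nonneg hx (weight_nonneg hσ hπ)
  have h2 := mul_nonneg hy (weight_nonneg hτ hπ)
  split_ifs with h
  · have h3 : x * weight σ π = 0 := by linarith
    have h4 : y * weight τ π = 0 := by linarith
    simp [h3, h4]
  · field_simp

lemma isSched_mix {x y : ℝ} (hx : 0 ≤ x) (hy : 0 ≤ y) {σ τ : Sched S A} (hσ : M.IsSched σ)
    (hτ : M.IsSched τ) : M.IsSched (mix x y σ τ) := by
  intro π hπ
  have h1 := mul_nonneg hx (weight_nonneg hσ hπ)
  have h2 := mul_nonneg hy (weight_nonneg hτ hπ)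
  obtain ⟨a1, a2, a3⟩ := hσ π hπ
  obtain ⟨b1, b2, b3⟩ := hτ π hπ
  by_cases h : x * weight σ π + y * weight τ π = 0
  · simpa only [mix, if_pos h] using hσ π hπ
  simp only [mix, if_neg h]
  refine ⟨fun a => ?_, fun a ha => ?_, fun ht => ?_⟩
  · have := a1 a
    have := b1 a
    positivity
  · by_contra hn
    have e1 : σ π a = 0 := by_contra fun h => hn (a2 a h)
    have e2 : τ π a = 0 := by_contra fun h => hn (b2 a h)
    simp [e1, e2] at ha
  · rw [← Finset.sum_div, Finset.sum_add_distrib, ← Finset.mul_sum, ← Finset.mul_sum, a3 ht,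
      b3 ht, mul_one, mul_one, div_self h]

lemma reachN_mix {x y : ℝ} (hx : 0 ≤ x) (hy : 0 ≤ y) {σ τ : Sched S A} (hσ : M.IsSched σ)
    (hτ : M.IsSched τ) (T : Set S) (n : ℕ) {π : FinPath S A} (hπ : M.Consistent π) :
    (x * weight σ π + y * weight τ π) * M.reachN (mix x y σ τ) T n π =
      x * weight σ π * M.reachN σ T n π + y * weight τ π * M.reachN τ T n π := by
  induction n generalizing π with
  | zero => unfold reachN; split_ifs <;> ring
  | succ n ih =>
    unfold reachN
    split_ifs
    · ring
    · simp only [Finset.mul_sum, ← Finset.sum_add_distrib]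
      refine Finset.sum_congr rfl fun a _ => Finset.sum_congr rfl fun s' _ => ?_
      by_cases h0 : M.prob π.last a s' = 0
      · simp [h0]
      have := ih (hπ.snoc h0)
      simp only [weight_snoc] at this
      linear_combination (M.prob π.last a s') * this +
        M.prob π.last a s' * M.reachN (mix x y σ τ) T n (π.snoc a s') *
          mix_mul hx hy hσ hτ hπ a

lemma Pr_mix (hM : M.Proper) {x y : ℝ} (hx : 0 ≤ x) (hy : 0 ≤ y) (hxy : x + y = 1)
    {σ τ : Sched S A} (hσ : M.IsSched σ) (hτ : M.IsSched τ) (s : S) (T : Set S) :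
    M.Pr (mix x y σ τ) s T = x * M.Pr σ s T + y * M.Pr τ s T := by
  refine tendsto_nhds_unique (tendsto_reachN hM (isSched_mix hx hy hσ hτ) T s) ?_
  refine (((tendsto_reachN hM hσ T s).const_mul x).add
    ((tendsto_reachN hM hτ T s).const_mul y)).congr fun n => ?_
  have := reachN_mix hx hy hσ hτ T n (consistent_nil (M := M) s)
  simpa [weight, weightFrom, hxy] using this.symm

end MDP

end SD

namespace SD

/-- If every nonnegative weight vector is at least as large on some element of a finite set as on
`p`, then `p` is dominated by a convex combination of that set. -/
lemma mem_dwConv_of_forall_weight {ι : Type} [Fintype ι] {F : Set (ι → ℝ)} (hF : F.Finite)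
    (hne : F.Nonempty) {p : ι → ℝ}
    (h : ∀ w : ι → ℝ, (∀ j, 0 ≤ w j) → ∃ f ∈ F, ∑ j, p j * w j ≤ ∑ j, f j * w j) :
    p ∈ dwConv F := by
  by_contra hp
  have hdisj : Disjoint (convexHull ℝ F) (Set.Ici p) := by
    rw [Set.disjoint_left]
    exact fun q hq hpq => hp ⟨q, hq, hpq⟩
  obtain ⟨φ, u, v, hu, huv, hv⟩ := geometric_hahn_banach_compact_closed (convex_convexHull ℝ F)
    (hF.isCompact_convexHull ℝ) (convex_Ici p) isClosed_Ici hdisj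
  have hφ : ∀ x : ι → ℝ, φ x = ∑ j, x j * φ (Pi.single j 1) := fun x => by
    conv_lhs => rw [pi_eq_sum_univ' x]
    simp [map_sum]
  obtain ⟨f, hf, hle⟩ := h (fun j => φ (Pi.single j 1)) fun j => by
    by_contra! hneg
    obtain ⟨q, hq⟩ := hne
    have hlt := (hu q (subset_convexHull ℝ F hq)).trans huv
    have hvp := hv p (Set.mem_Ici.2 le_rfl)
    set c := φ (Pi.single j 1)
    have ht : 0 ≤ (φ p - v) / (-c) := div_nonneg (by linarith) (by linarith)
    have := hv (p + ((φ p - v) / (-c)) • Pi.single j 1) (by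
      have h1 : (0 : ι → ℝ) ≤ Pi.single j 1 := Pi.single_nonneg.2 zero_le_one
      exact le_add_of_nonneg_right (a := p) (smul_nonneg ht h1))
    rw [map_add, map_smul, smul_eq_mul] at this
    have e : (φ p - v) / (-c) * c = -(φ p - v) := by
      have : c ≠ 0 := hneg.ne
      field_simp
    linarith
  rw [← hφ, ← hφ] at hle
  have := hu f (subset_convexHull ℝ F hf)
  have := hv p (Set.mem_Ici.2 le_rfl)
  linarith

namespace MDP

variable {S A : Type} [Fintype S] [Fintype A] {M : MDP S A}

/-- Nonnegative functions on states that do not increase in expectation along any action. -/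
def Super (M : MDP S A) (V : S → ℝ) : Prop :=
  (∀ s, 0 ≤ V s) ∧ ∀ s a, ∑ s', M.prob s a s' * V s' ≤ V s

/-- The value of stopping with reward `w` (`none`), or of playing an action with discount `β` and
continuation value `v`. -/
noncomputable def step (M : MDP S A) (w : S → ℝ) (β : ℝ) (v : S → ℝ) (s : S) : Option A → ℝ
  | none => w s
  | some a => β * ∑ s', M.prob s a s' * v s'

/-- The discounted value of the stopping policy `d` within `n` steps. -/
noncomputable def policyVal (M : MDP S A) (w : S → ℝ) (β : ℝ) (d : S → Option A) :
    ℕ → S → ℝ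
  | 0, _ => 0
  | n + 1, s => M.step w β (policyVal M w β d n) s (d s)

lemma Proper.sum_prob_mono (hM : M.Proper) (s : S) (a : A) {v v' : S → ℝ}
    (h : ∀ s, v s ≤ v' s) : ∑ s', M.prob s a s' * v s' ≤ ∑ s', M.prob s a s' * v' s' :=
  Finset.sum_le_sum fun s' _ => mul_le_mul_of_nonneg_left (h s') (hM.prob_nonneg s a s')

lemma Proper.sum_prob_add_le (hM : M.Proper) (s : S) (a : A) {v v' : S → ℝ} {c : ℝ}
    (hc : 0 ≤ c) (h : ∀ s, v s ≤ v' s + c) :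
    ∑ s', M.prob s a s' * v s' ≤ (∑ s', M.prob s a s' * v' s') + c := by
  refine (hM.sum_prob_mono s a h).trans ?_
  simp only [mul_add, Finset.sum_add_distrib, ← Finset.sum_mul]
  have := mul_le_mul_of_nonneg_right (hM.sum_prob_le s a) hc
  linarith

lemma step_mono (hM : M.Proper) (w : S → ℝ) {β β' : ℝ} (hβ : 0 ≤ β) (hβ' : β ≤ β')
    {v v' : S → ℝ} (h : ∀ s, v s ≤ v' s) (h0 : ∀ s, 0 ≤ v' s) (s : S) (o : Option A) :
    M.step w β v s o ≤ M.step w β' v' s o := by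
  cases o with
  | none => exact le_rfl
  | some a =>
    exact (mul_le_mul_of_nonneg_left (hM.sum_prob_mono s a h) hβ).trans
      (mul_le_mul_of_nonneg_right hβ'
        (Finset.sum_nonneg fun s' _ => mul_nonneg (hM.prob_nonneg s a s') (h0 s')))

lemma step_sub_le (hM : M.Proper) (w : S → ℝ) {β : ℝ} (hβ : 0 ≤ β) {v v' : S → ℝ} {c : ℝ}
    (hc : 0 ≤ c) (h : ∀ s, v s ≤ v' s + c) (s : S) (o : Option A) :
    M.step w β v s o ≤ M.step w β v' s o + β * c := by
  cases o with
  | none => exact le_add_of_nonneg_right (mul_nonneg hβ hc)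
  | some a =>
    have := mul_le_mul_of_nonneg_left (hM.sum_prob_add_le s a hc h) hβ
    simpa only [step, mul_add] using this

lemma exists_discounted_fixedPoint (hM : M.Proper) (w : S → ℝ) {β : ℝ} (hβ : 0 ≤ β)
    (hβ1 : β < 1) : ∃ (V : S → ℝ) (d : S → Option A),
      (∀ s o, M.step w β V s o ≤ V s) ∧ ∀ s, V s = M.step w β V s (d s) := by
  let T : (S → ℝ) → S → ℝ := fun v s =>
    Finset.univ.sup' Finset.univ_nonempty fun o : Option A => M.step w β v s o
  have hle : ∀ v s o, M.step w β v s o ≤ T v s := fun v s o =>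
    Finset.le_sup' (fun o : Option A => M.step w β v s o) (Finset.mem_univ o)
  have hT : ∀ v v' s, T v s ≤ T v' s + β * dist v v' := fun v v' s => by
    refine Finset.sup'_le _ _ fun o _ => ?_
    refine (step_sub_le hM w hβ dist_nonneg (v' := v') (fun t => ?_) s o).trans
      (add_le_add_left (hle v' s o) _)
    have := (Real.dist_eq _ _ ▸ dist_le_pi_dist v v' t : |v t - v' t| ≤ _)
    linarith [le_abs_self (v t - v' t)]
  have hC : ContractingWith ⟨β, hβ⟩ T := by
    refine ⟨hβ1, LipschitzWith.of_dist_le_mul fun v v' => ?_⟩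
    refine (dist_pi_le_iff (mul_nonneg hβ dist_nonneg)).2 fun s => ?_
    rw [Real.dist_eq, abs_sub_le_iff]
    have h1 := hT v v' s
    have h2 := hT v' v s
    rw [dist_comm v' v] at h2
    exact ⟨by simpa using by linarith, by simpa using by linarith⟩
  have hfix : T (hC.fixedPoint T) = hC.fixedPoint T := hC.fixedPoint_isFixedPt
  have hd : ∀ s, ∃ o : Option A, T (hC.fixedPoint T) s = M.step w β (hC.fixedPoint T) s o :=
    fun s => by
      obtain ⟨o, -, ho⟩ := Finset.exists_mem_eq_sup' Finset.univ_nonempty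
        fun o : Option A => M.step w β (hC.fixedPoint T) s o
      exact ⟨o, ho⟩
  choose d hd using hd
  exact ⟨hC.fixedPoint T, d, fun s o => (hle _ s o).trans (congrFun hfix s).le,
    fun s => (congrFun hfix s).symm.trans (hd s)⟩

section policyVal

variable {w : S → ℝ} {β : ℝ} {d : S → Option A}

lemma policyVal_le_of_step_le (hM : M.Proper) (hβ : 0 ≤ β) {V : S → ℝ} (hV0 : ∀ s, 0 ≤ V s)
    (hV : ∀ s o, M.step w β V s o ≤ V s) (n : ℕ) (s : S) : M.policyVal w β d n s ≤ V s := by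
  induction n generalizing s with
  | zero => exact hV0 s
  | succ n ih => exact (step_mono hM w hβ le_rfl ih hV0 s _).trans (hV s _)

lemma le_policyVal_add (hM : M.Proper) (hβ : 0 ≤ β) {V : S → ℝ} {C : ℝ} (hC : 0 ≤ C)
    (hVC : ∀ s, V s ≤ C) (hV : ∀ s, V s = M.step w β V s (d s)) (n : ℕ) (s : S) :
    V s ≤ M.policyVal w β d n s + β ^ n * C := by
  induction n generalizing s with
  | zero => simpa [policyVal] using hVC s
  | succ n ih =>
    rw [hV s, pow_succ', mul_assoc]
    exact step_sub_le hM w hβ (mul_nonneg (pow_nonneg hβ n) hC) ih s (d s)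

lemma policyVal_nonneg (hM : M.Proper) (hw : ∀ s, 0 ≤ w s) (hβ : 0 ≤ β) (n : ℕ) (s : S) :
    0 ≤ M.policyVal w β d n s := by
  induction n generalizing s with
  | zero => exact le_rfl
  | succ n ih =>
    unfold policyVal
    cases d s with
    | none => exact hw s
    | some a =>
      exact mul_nonneg hβ
        (Finset.sum_nonneg fun s' _ => mul_nonneg (hM.prob_nonneg s a s') (ih s'))

lemma policyVal_le_succ (hM : M.Proper) (hw : ∀ s, 0 ≤ w s) (hβ : 0 ≤ β) (n : ℕ) (s : S) :
    M.policyVal w β d n s ≤ M.policyVal w β d (n + 1) s := by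
  induction n generalizing s with
  | zero => exact policyVal_nonneg hM hw hβ 1 s
  | succ n ih => exact step_mono hM w hβ le_rfl ih (policyVal_nonneg hM hw hβ _) s _

lemma policyVal_le_one (hM : M.Proper) (hw : ∀ s, 0 ≤ w s) (hβ : 0 ≤ β) (hβ1 : β ≤ 1) (n : ℕ)
    (s : S) : M.policyVal w β d n s ≤ M.policyVal w 1 d n s := by
  induction n generalizing s with
  | zero => exact le_rfl
  | succ n ih => exact step_mono hM w hβ hβ1 ih (policyVal_nonneg hM hw zero_le_one _) s _

lemma policyVal_le_sum (hM : M.Proper) (hw : ∀ s, 0 ≤ w s) (n : ℕ) (s : S) :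
    M.policyVal w 1 d n s ≤ ∑ s, w s := by
  have h0 : 0 ≤ ∑ s, w s := Finset.sum_nonneg fun s _ => hw s
  refine policyVal_le_of_step_le hM zero_le_one (V := fun _ => ∑ s, w s) (fun _ => h0) ?_ n s
  rintro s (_ | a)
  · exact Finset.single_le_sum (fun s _ => hw s) (Finset.mem_univ s)
  · simp only [step, one_mul, ← Finset.sum_mul]
    exact mul_le_of_le_one_left h0 (hM.sum_prob_le s a)

lemma continuous_policyVal (n : ℕ) (s : S) : Continuous fun β => M.policyVal w β d n s := by
  induction n generalizing s with
  | zero => exact continuous_const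
  | succ n ih =>
    unfold policyVal
    cases d s with
    | none => exact continuous_const
    | some a =>
      exact continuous_id.mul (continuous_finsetSum _ fun s' _ => (ih s').const_mul _)

end policyVal

/-- Some stopping policy is optimal, simultaneously from all states: its value is a
supersolution of the optimality equation. The policy is one that is optimal for discount factors
arbitrarily close to 1. -/
lemma exists_optimal_policy (hM : M.Proper) {w : S → ℝ} (hw : ∀ s, 0 ≤ w s) :
    ∃ (d : S → Option A) (R : S → ℝ), M.Super R ∧ (∀ s, w s ≤ R s) ∧
      ∀ s, Filter.Tendsto (fun n => M.policyVal w 1 d n s) Filter.atTop (nhds (R s)) := by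
  let R : (S → Option A) → S → ℝ := fun d s => ⨆ n, M.policyVal w 1 d n s
  have hR : ∀ d s, Filter.Tendsto (fun n => M.policyVal w 1 d n s) Filter.atTop
      (nhds (R d s)) := fun d s => by
    refine tendsto_atTop_ciSup
      (monotone_nat_of_le_succ fun n => policyVal_le_succ hM hw zero_le_one n s) ⟨∑ s, w s, ?_⟩
    rintro _ ⟨n, rfl⟩
    exact policyVal_le_sum hM hw n s
  have hle : ∀ d s n, M.policyVal w 1 d n s ≤ R d s := fun d s n =>
    (monotone_nat_of_le_succ fun n =>
      policyVal_le_succ hM hw zero_le_one n s).ge_of_tendsto (hR d s) n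
  have key : ∀ β : ℝ, 0 ≤ β → β < 1 → ∃ d : S → Option A, ∀ s, w s ≤ R d s ∧
      ∀ a n, β * ∑ s', M.prob s a s' * M.policyVal w β d n s' ≤ R d s := by
    intro β hβ hβ1
    obtain ⟨V, d, hV, hd⟩ := exists_discounted_fixedPoint hM w hβ hβ1
    have hV0 : ∀ s, 0 ≤ V s := fun s => (hw s).trans (hV s none)
    have hVR : ∀ s, V s ≤ R d s := fun s => by
      have hlim : Filter.Tendsto (fun n : ℕ => R d s + β ^ n * ∑ s, V s) Filter.atTop
          (nhds (R d s + 0 * ∑ s, V s)) :=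
        ((tendsto_pow_atTop_nhds_zero_of_lt_one hβ hβ1).mul_const _).const_add _
      rw [zero_mul, add_zero] at hlim
      refine ge_of_tendsto' hlim fun n => ?_
      refine (le_policyVal_add hM hβ (Finset.sum_nonneg fun s _ => hV0 s) (fun s =>
        Finset.single_le_sum (fun s _ => hV0 s) (Finset.mem_univ s)) hd n s).trans ?_
      exact add_le_add_left ((policyVal_le_one hM hw hβ hβ1.le n s).trans (hle d s n)) _
    refine ⟨d, fun s => ⟨(hV s none).trans (hVR s), fun a n => ?_⟩⟩
    refine le_trans ?_ ((hV s (some a)).trans (hVR s))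
    exact step_mono hM w hβ le_rfl (policyVal_le_of_step_le hM hβ hV0 hV n) hV0 s (some a)
  have hfreq : ∃ d : S → Option A, ∃ᶠ β in nhdsWithin (1 : ℝ) (Set.Iio 1), ∀ s, w s ≤ R d s ∧
      ∀ a n, β * ∑ s', M.prob s a s' * M.policyVal w β d n s' ≤ R d s := by
    by_contra hcon
    simp only [not_exists, Filter.not_frequently] at hcon
    have h1 := Filter.eventually_all.2 hcon
    have h2 : ∀ᶠ β : ℝ in nhdsWithin (1 : ℝ) (Set.Iio 1), 0 ≤ β ∧ β < 1 := by
      filter_upwards [Ioo_mem_nhdsLT (zero_lt_one' ℝ)] with β hβ using ⟨hβ.1.le, hβ.2⟩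
    obtain ⟨β, hβ, h0, hlt⟩ := (h1.and h2).exists
    obtain ⟨d, hd⟩ := key β h0 hlt
    exact hβ d hd
  obtain ⟨d, hd⟩ := hfreq
  have hwR : ∀ s, w s ≤ R d s := fun s => by
    obtain ⟨β, hβ⟩ := hd.exists
    exact (hβ s).1
  refine ⟨d, R d, ⟨fun s => (hw s).trans (hwR s), fun s a => ?_⟩, hwR, hR d⟩
  refine le_of_tendsto' (tendsto_finsetSum _ fun s' _ => (hR d s').const_mul _) fun n => ?_
  have hcont : Continuous fun β : ℝ => β * ∑ s', M.prob s a s' * M.policyVal w β d n s' :=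
    continuous_id.mul
      (continuous_finsetSum _ fun s' _ => (continuous_policyVal n s').const_mul _)
  have ht := (hcont.tendsto 1).mono_left (nhdsWithin_le_nhds (s := Set.Iio (1 : ℝ)))
  rw [one_mul] at ht
  exact le_of_tendsto_of_frequently ht (hd.mono fun β h => (h s).2 a n)

/-- A stopping policy as a total choice of enabled actions: an arbitrary enabled action replaces
the policy where it stops or proposes a disabled action. -/
noncomputable def pick (M : MDP S A) (d : S → Option A) (s : S) : Option A :=
  if ∃ a, d s = some a ∧ M.enabled s a then d s
  else if h : ∃ a, M.enabled s a then some h.choose else none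

/-- The deterministic memoryless scheduler of a stopping policy. -/
noncomputable def policySched (M : MDP S A) (d : S → Option A) : Sched S A := fun π a =>
  if M.pick d π.last = some a then 1 else 0

lemma pick_enabled {d : S → Option A} {s : S} {a : A} (h : M.pick d s = some a) :
    M.enabled s a := by
  unfold pick at h
  split_ifs at h with h1 h2
  · obtain ⟨b, hb, hb'⟩ := h1
    rw [hb] at h
    exact Option.some.inj h ▸ hb'
  · exact Option.some.inj h ▸ h2.choose_spec

lemma exists_pick {d : S → Option A} {s : S} (h : ¬ M.terminal s) :
    ∃ a, M.pick d s = some a := by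
  have h2 : ∃ a, M.enabled s a := by simpa [terminal, enabled] using h
  unfold pick
  split_ifs with h1
  · exact h1.imp fun a ha => ha.1
  · exact ⟨_, rfl⟩

lemma isSched_policySched (d : S → Option A) : M.IsSched (M.policySched d) := by
  intro π _
  refine ⟨fun a => ?_, fun a ha => ?_, fun ht => ?_⟩
  · unfold policySched; split_ifs <;> norm_num
  · unfold policySched at ha
    split_ifs at ha with h
    · exact pick_enabled h
    · exact absurd rfl ha
  · obtain ⟨a, ha⟩ := exists_pick (d := d) ht
    simp [policySched, ha]

end MDP

end SD

namespace SD

namespace OMDP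

variable {S A : Type} [Fintype S] [Fintype A] {𝒜 : OMDP S A}

/-- The transitions are probability distributions and the exits are terminal. -/
def TerminalExits (𝒜 : OMDP S A) : Prop :=
  𝒜.M.Proper ∧ ∀ s ∈ 𝒜.exit, 𝒜.M.terminal s

lemma WF.terminalExits (h : 𝒜.WF) : 𝒜.TerminalExits := ⟨h.1, fun s hs => (h.2.2 s).1 hs⟩

lemma TerminalExits.prob_eq_zero (h : 𝒜.TerminalExits) {s : S} (hs : s ∈ 𝒜.exit) (a : A)
    (s' : S) : 𝒜.M.prob s a s' = 0 :=
  MDP.prob_eq_zero ((h.2 s hs).not_enabled a) s'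

lemma TerminalExits.reachN_exit (h : 𝒜.TerminalExits) (σ : Sched S A) (n : ℕ)
    {π : FinPath S A} (hπ : π.last ∈ 𝒜.exit) (T : Set S) :
    𝒜.M.reachN σ T n π = if π.last ∈ T then 1 else 0 := by
  cases n with
  | zero => rfl
  | succ n => simp [MDP.reachN, h.prob_eq_zero hπ]

lemma reachN_succ_of_not_exit (σ : Sched S A) (n : ℕ) {π : FinPath S A}
    (hπ : π.last ∉ 𝒜.exit) (j : 𝒜.ExitIdx) :
    𝒜.M.reachN σ {j.1} (n + 1) π =
      ∑ a, σ π a * ∑ s', 𝒜.M.prob π.last a s' * 𝒜.M.reachN σ {j.1} n (π.snoc a s') := by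
  have : π.last ≠ j.1 := fun h => hπ (h ▸ j.2)
  simp [MDP.reachN, this]

/-- The expected reward within `n` steps, for the reward `V` on the exits. -/
noncomputable def rewardN (𝒜 : OMDP S A) (σ : Sched S A) (V : S → ℝ) (n : ℕ)
    (π : FinPath S A) : ℝ :=
  ∑ j : 𝒜.ExitIdx, 𝒜.M.reachN σ {j.1} n π * V j.1

lemma TerminalExits.rewardN_exit (h : 𝒜.TerminalExits) (σ : Sched S A) (V : S → ℝ) (n : ℕ)
    {π : FinPath S A} (hπ : π.last ∈ 𝒜.exit) : 𝒜.rewardN σ V n π = V π.last := by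
  unfold rewardN
  rw [Finset.sum_eq_single (⟨π.last, hπ⟩ : 𝒜.ExitIdx)]
  · simp [h.reachN_exit σ n hπ]
  · intro j _ hj
    have : π.last ≠ j.1 := fun h => hj (Subtype.ext h.symm)
    simp [h.reachN_exit σ n hπ, this]
  · simp

lemma rewardN_zero (σ : Sched S A) (V : S → ℝ) {π : FinPath S A} (hπ : π.last ∉ 𝒜.exit) :
    𝒜.rewardN σ V 0 π = 0 := by
  refine Finset.sum_eq_zero fun j _ => ?_
  have : π.last ≠ j.1 := fun h => hπ (h ▸ j.2)
  simp [MDP.reachN, this]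

lemma rewardN_succ (σ : Sched S A) (V : S → ℝ) (n : ℕ) {π : FinPath S A}
    (hπ : π.last ∉ 𝒜.exit) :
    𝒜.rewardN σ V (n + 1) π =
      ∑ a, σ π a * ∑ s', 𝒜.M.prob π.last a s' * 𝒜.rewardN σ V n (π.snoc a s') := by
  simp only [rewardN, reachN_succ_of_not_exit σ n hπ, Finset.mul_sum, Finset.sum_mul]
  rw [Finset.sum_comm]
  refine Finset.sum_congr rfl fun a _ => ?_
  rw [Finset.sum_comm]
  exact Finset.sum_congr rfl fun s' _ => Finset.sum_congr rfl fun j _ => by ring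

lemma rewardN_le (h : 𝒜.TerminalExits) {σ : Sched S A} (hσ : 𝒜.M.IsSched σ) {V : S → ℝ}
    (hV : 𝒜.M.Super V) (n : ℕ) {π : FinPath S A} (hπ : 𝒜.M.Consistent π) :
    𝒜.rewardN σ V n π ≤ V π.last := by
  by_cases he : π.last ∈ 𝒜.exit
  · exact (h.rewardN_exit σ V n he).le
  induction n generalizing π with
  | zero => exact (rewardN_zero σ V he).trans_le (hV.1 _)
  | succ n ih =>
    rw [rewardN_succ σ V n he]
    have h1 := hσ.expect_mono h.1 hπ (f := fun a s' => 𝒜.rewardN σ V n (π.snoc a s'))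
      (g := fun _ s' => V s') fun a s' hc => by
        by_cases he' : (π.snoc a s').last ∈ 𝒜.exit
        · simpa using (h.rewardN_exit σ V n he').le
        · simpa using ih hc he'
    refine h1.trans ?_
    refine (Finset.sum_le_sum fun a _ =>
      mul_le_mul_of_nonneg_left (hV.2 π.last a) ((hσ π hπ).1 a)).trans ?_
    rw [← Finset.sum_mul]
    exact mul_le_of_le_one_left (hV.1 _) (hσ.sum_le_one hπ)

lemma tendsto_rewardN (h : 𝒜.TerminalExits) {σ : Sched S A} (hσ : 𝒜.M.IsSched σ)
    (V : S → ℝ) (s : S) : Filter.Tendsto (fun n => 𝒜.rewardN σ V n ⟨s, []⟩) Filter.atTop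
      (nhds (∑ j : 𝒜.ExitIdx, 𝒜.prVec σ s j * V j.1)) :=
  tendsto_finsetSum _ fun j _ => (MDP.tendsto_reachN h.1 hσ {j.1} s).mul_const _

lemma sum_prVec_mul_le (h : 𝒜.TerminalExits) {σ : Sched S A} (hσ : 𝒜.M.IsSched σ)
    {V : S → ℝ} (hV : 𝒜.M.Super V) (s : S) :
    ∑ j : 𝒜.ExitIdx, 𝒜.prVec σ s j * V j.1 ≤ V s :=
  le_of_tendsto' (tendsto_rewardN h hσ V s) fun n =>
    rewardN_le h hσ hV n (MDP.consistent_nil s)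

lemma sum_prVec_mul_of_exit (h : 𝒜.TerminalExits) {σ : Sched S A} (hσ : 𝒜.M.IsSched σ)
    (V : S → ℝ) {s : S} (hs : s ∈ 𝒜.exit) :
    ∑ j : 𝒜.ExitIdx, 𝒜.prVec σ s j * V j.1 = V s :=
  tendsto_nhds_unique (tendsto_rewardN h hσ V s)
    (tendsto_const_nhds.congr fun n => (h.rewardN_exit σ V n (π := ⟨s, []⟩) hs).symm)

lemma policyVal_le_rewardN (h : 𝒜.TerminalExits) {V : S → ℝ} (hV : ∀ s, 0 ≤ V s)
    (d : S → Option A) (n : ℕ) (π : FinPath S A) :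
    𝒜.M.policyVal (fun s => if s ∈ 𝒜.exit then V s else 0) 1 d n π.last ≤
      𝒜.rewardN (𝒜.M.policySched d) V n π := by
  set w : S → ℝ := fun s => if s ∈ 𝒜.exit then V s else 0 with hwdef
  have hw : ∀ s, 0 ≤ w s := fun s => by
    simp only [hwdef]
    split_ifs
    exacts [hV s, le_rfl]
  have hexit : ∀ n (π : FinPath S A), π.last ∈ 𝒜.exit →
      𝒜.M.policyVal w 1 d n π.last ≤ 𝒜.rewardN (𝒜.M.policySched d) V n π := by
    intro n π he
    rw [h.rewardN_exit _ V n he]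
    cases n with
    | zero => exact hV _
    | succ n =>
      unfold MDP.policyVal
      cases d π.last with
      | none => simp [MDP.step, hwdef, he]
      | some a => simpa [MDP.step, h.prob_eq_zero he] using hV _
  by_cases he : π.last ∈ 𝒜.exit
  · exact hexit n π he
  induction n generalizing π with
  | zero => exact (rewardN_zero _ V he).ge
  | succ n ih =>
    have ih' : ∀ a s', 𝒜.M.policyVal w 1 d n s' ≤
        𝒜.rewardN (𝒜.M.policySched d) V n (π.snoc a s') := fun a s' => by
      by_cases he' : (π.snoc a s').last ∈ 𝒜.exit
      · simpa using hexit n _ he'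
      · simpa using ih _ he'
    have hnn : ∀ a, 0 ≤ ∑ s', 𝒜.M.prob π.last a s' *
        𝒜.rewardN (𝒜.M.policySched d) V n (π.snoc a s') := fun a =>
      Finset.sum_nonneg fun s' _ => mul_nonneg (h.1.prob_nonneg _ _ _)
        ((MDP.policyVal_nonneg h.1 hw zero_le_one n s').trans (ih' a s'))
    have hnn' : ∀ a, 0 ≤ 𝒜.M.policySched d π a := fun a => by
      unfold MDP.policySched; split_ifs <;> norm_num
    rw [rewardN_succ _ V n he]
    have h0 := Finset.sum_nonneg fun a (_ : a ∈ Finset.univ) => mul_nonneg (hnn' a) (hnn a)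
    unfold MDP.policyVal
    cases hd : d π.last with
    | none => simpa [MDP.step, hwdef, he] using h0
    | some a =>
      by_cases hen : 𝒜.M.enabled π.last a
      · have hp : 𝒜.M.pick d π.last = some a := by
          rw [MDP.pick, if_pos ⟨a, hd, hen⟩, hd]
        refine le_trans ?_ (Finset.single_le_sum
          (fun a _ => mul_nonneg (hnn' a) (hnn a)) (Finset.mem_univ a))
        simp only [MDP.step, MDP.policySched, hp, if_true]
        exact mul_le_mul_of_nonneg_left (Finset.sum_le_sum fun s' _ =>
          mul_le_mul_of_nonneg_left (ih' a s') (h.1.prob_nonneg _ _ _)) zero_le_one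
      · simpa [MDP.step, MDP.prob_eq_zero hen] using h0

/-- For every reward on the exits, the value is attained by a policy scheduler and is a
supersolution. -/
lemma exists_optimal (h : 𝒜.TerminalExits) {g : S → ℝ} (hg : ∀ s, 0 ≤ g s) :
    ∃ (V : S → ℝ) (d : S → Option A), 𝒜.M.Super V ∧ (∀ s ∈ 𝒜.exit, V s = g s) ∧
      ∀ s, V s ≤ ∑ j : 𝒜.ExitIdx, 𝒜.prVec (𝒜.M.policySched d) s j * g j.1 := by
  obtain ⟨d, V, hV, hwV, hlim⟩ := MDP.exists_optimal_policy h.1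
    (w := fun s => if s ∈ 𝒜.exit then g s else 0) fun s => by
      split_ifs
      exacts [hg s, le_rfl]
  have hle : ∀ s, V s ≤ ∑ j : 𝒜.ExitIdx, 𝒜.prVec (𝒜.M.policySched d) s j * g j.1 :=
    fun s => le_of_tendsto_of_tendsto' (hlim s)
      (tendsto_rewardN h (MDP.isSched_policySched d) g s)
      fun n => policyVal_le_rewardN h hg d n ⟨s, []⟩
  refine ⟨V, d, hV, fun s hs => le_antisymm ?_ ?_, hle⟩
  · exact (hle s).trans (sum_prVec_mul_of_exit h (MDP.isSched_policySched d) g hs).le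
  · simpa [hs] using hwV s

lemma sum_mul_le_of_mem_achievable (h : 𝒜.TerminalExits) {s : S} {p : 𝒜.ExitIdx → ℝ}
    (hp : p ∈ 𝒜.achievable s) {V : S → ℝ} (hV : 𝒜.M.Super V) :
    ∑ j : 𝒜.ExitIdx, p j * V j.1 ≤ V s := by
  obtain ⟨σ, hσ, hle⟩ := hp
  exact (Finset.sum_le_sum fun j _ =>
    mul_le_mul_of_nonneg_right (hle j) (hV.1 j.1)).trans (sum_prVec_mul_le h hσ hV s)

lemma convex_achievable (h : 𝒜.M.Proper) (s : S) : Convex ℝ (𝒜.achievable s) := by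
  rintro p ⟨σ, hσ, hp⟩ q ⟨τ, hτ, hq⟩ x y hx hy hxy
  refine ⟨MDP.mix x y σ τ, MDP.isSched_mix hx hy hσ hτ, fun j => ?_⟩
  have := MDP.Pr_mix h hx hy hxy hσ hτ s {j.1}
  simp only [prVec, this, Pi.add_apply, Pi.smul_apply, smul_eq_mul]
  exact add_le_add (mul_le_mul_of_nonneg_left (hp j) hx) (mul_le_mul_of_nonneg_left (hq j) hy)

/-- A point is achievable as soon as no supersolution separates it. -/
lemma mem_achievable_of_forall_super (h : 𝒜.TerminalExits) {s : S} {p : 𝒜.ExitIdx → ℝ}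
    (hp : ∀ V, 𝒜.M.Super V → ∑ j : 𝒜.ExitIdx, p j * V j.1 ≤ V s) :
    p ∈ 𝒜.achievable s := by
  have hmem : p ∈ dwConv (Set.range fun d => 𝒜.prVec (𝒜.M.policySched d) s) := by
    refine mem_dwConv_of_forall_weight (Set.finite_range _) (Set.range_nonempty _)
      fun w hw => ?_
    have hext : ∀ j : 𝒜.ExitIdx, (fun t => if ht : t ∈ 𝒜.exit then w ⟨t, ht⟩ else 0) j.1 = w j :=
      fun j => by simp [j.2]
    obtain ⟨V, d, hV, hVe, hle⟩ := exists_optimal h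
      (g := fun t => if ht : t ∈ 𝒜.exit then w ⟨t, ht⟩ else 0) fun t => by
        split_ifs
        exacts [hw _, le_rfl]
    refine ⟨_, ⟨d, rfl⟩, ?_⟩
    have h1 := (hp V hV).trans (hle s)
    simpa only [fun j : 𝒜.ExitIdx => hVe j.1 j.2, hext] using h1
  obtain ⟨q, hq, hpq⟩ := hmem
  have hsub : convexHull ℝ (Set.range fun d => 𝒜.prVec (𝒜.M.policySched d) s) ⊆
      𝒜.achievable s := by
    refine convexHull_min ?_ (convex_achievable h.1 s)
    rintro _ ⟨d, rfl⟩
    exact ⟨_, MDP.isSched_policySched d, le_rfl⟩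
  obtain ⟨σ, hσ, hqσ⟩ := hsub hq
  exact ⟨σ, hσ, hpq.trans hqσ⟩

end OMDP

end SD

namespace SD

namespace OMDP

section seqComp

variable {S₁ A₁ S₂ A₂ : Type} [Fintype S₁] [Fintype A₁] [Fintype S₂] [Fintype A₂]
  {𝒜 : OMDP S₁ A₁} {ℬ : OMDP S₂ A₂} {h₁ : 𝒜.Or.length = ℬ.Ir.length}
  {h₂ : ℬ.Ol.length = 𝒜.Il.length}

lemma seqComp_P_Or (hnd : 𝒜.Or.Nodup) (n : ℕ) (hn : n < 𝒜.Or.length) (a : A₁ ⊕ A₂) :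
    (𝒜.seqComp ℬ h₁ h₂).M.P (Sum.inl 𝒜.Or[n]) a =
      some fun t => if t = Sum.inr (ℬ.Ir[n]'(h₁ ▸ hn)) then 1 else 0 := by
  have h : ∃ k : Fin 𝒜.Or.length, 𝒜.Or.get k = 𝒜.Or[n] := ⟨⟨n, hn⟩, rfl⟩
  have hk : h.choose = ⟨n, hn⟩ := hnd.injective_get h.choose_spec
  simp only [seqComp]
  rw [dif_pos h]
  simp [hk]

lemma seqComp_P_Ol (hnd : ℬ.Ol.Nodup) (n : ℕ) (hn : n < ℬ.Ol.length) (a : A₁ ⊕ A₂) :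
    (𝒜.seqComp ℬ h₁ h₂).M.P (Sum.inr ℬ.Ol[n]) a =
      some fun t => if t = Sum.inl (𝒜.Il[n]'(h₂ ▸ hn)) then 1 else 0 := by
  have h : ∃ k : Fin ℬ.Ol.length, ℬ.Ol.get k = ℬ.Ol[n] := ⟨⟨n, hn⟩, rfl⟩
  have hk : h.choose = ⟨n, hn⟩ := hnd.injective_get h.choose_spec
  simp only [seqComp]
  rw [dif_pos h]
  simp [hk]

lemma seqComp_P_inl {s : S₁} (hs : s ∉ 𝒜.Or) (a : A₁) :
    (𝒜.seqComp ℬ h₁ h₂).M.P (Sum.inl s) (Sum.inl a) =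
      (𝒜.M.P s a).map fun d => Sum.elim d fun _ => 0 := by
  have h : ¬ ∃ k : Fin 𝒜.Or.length, 𝒜.Or.get k = s := fun h => hs (List.mem_iff_get.2 h)
  simp only [seqComp]
  rw [dif_neg h]

lemma seqComp_P_inl_inr {s : S₁} (hs : s ∉ 𝒜.Or) (a : A₂) :
    (𝒜.seqComp ℬ h₁ h₂).M.P (Sum.inl s) (Sum.inr a) = none := by
  have h : ¬ ∃ k : Fin 𝒜.Or.length, 𝒜.Or.get k = s := fun h => hs (List.mem_iff_get.2 h)
  simp only [seqComp]
  rw [dif_neg h]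

lemma seqComp_P_inr {s : S₂} (hs : s ∉ ℬ.Ol) (a : A₂) :
    (𝒜.seqComp ℬ h₁ h₂).M.P (Sum.inr s) (Sum.inr a) =
      (ℬ.M.P s a).map fun d => Sum.elim (fun _ => 0) d := by
  have h : ¬ ∃ k : Fin ℬ.Ol.length, ℬ.Ol.get k = s := fun h => hs (List.mem_iff_get.2 h)
  simp only [seqComp]
  rw [dif_neg h]

lemma seqComp_P_inr_inl {s : S₂} (hs : s ∉ ℬ.Ol) (a : A₁) :
    (𝒜.seqComp ℬ h₁ h₂).M.P (Sum.inr s) (Sum.inl a) = none := by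
  have h : ¬ ∃ k : Fin ℬ.Ol.length, ℬ.Ol.get k = s := fun h => hs (List.mem_iff_get.2 h)
  simp only [seqComp]
  rw [dif_neg h]

lemma sum_prob_seqComp_Or (hnd : 𝒜.Or.Nodup) (n : ℕ) (hn : n < 𝒜.Or.length) (a : A₁ ⊕ A₂)
    (V : S₁ ⊕ S₂ → ℝ) :
    ∑ t, (𝒜.seqComp ℬ h₁ h₂).M.prob (Sum.inl 𝒜.Or[n]) a t * V t =
      V (Sum.inr (ℬ.Ir[n]'(h₁ ▸ hn))) := by
  simp only [MDP.prob, seqComp_P_Or hnd n hn a, Option.elim_some, ite_mul, one_mul, zero_mul]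
  simp

lemma sum_prob_seqComp_Ol (hnd : ℬ.Ol.Nodup) (n : ℕ) (hn : n < ℬ.Ol.length) (a : A₁ ⊕ A₂)
    (V : S₁ ⊕ S₂ → ℝ) :
    ∑ t, (𝒜.seqComp ℬ h₁ h₂).M.prob (Sum.inr ℬ.Ol[n]) a t * V t =
      V (Sum.inl (𝒜.Il[n]'(h₂ ▸ hn))) := by
  simp only [MDP.prob, seqComp_P_Ol hnd n hn a, Option.elim_some, ite_mul, one_mul, zero_mul]
  simp

lemma sum_prob_seqComp_inl {s : S₁} (hs : s ∉ 𝒜.Or) (a : A₁) (V : S₁ ⊕ S₂ → ℝ) :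
    ∑ t, (𝒜.seqComp ℬ h₁ h₂).M.prob (Sum.inl s) (Sum.inl a) t * V t =
      ∑ t, 𝒜.M.prob s a t * V (Sum.inl t) := by
  simp only [MDP.prob, seqComp_P_inl hs a]
  cases 𝒜.M.P s a <;> simp

lemma sum_prob_seqComp_inr {s : S₂} (hs : s ∉ ℬ.Ol) (a : A₂) (V : S₁ ⊕ S₂ → ℝ) :
    ∑ t, (𝒜.seqComp ℬ h₁ h₂).M.prob (Sum.inr s) (Sum.inr a) t * V t =
      ∑ t, ℬ.M.prob s a t * V (Sum.inr t) := by
  simp only [MDP.prob, seqComp_P_inr hs a]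
  cases ℬ.M.P s a <;> simp

lemma super_seqComp (hndA : 𝒜.Or.Nodup) (hndB : ℬ.Ol.Nodup) {V : S₁ ⊕ S₂ → ℝ}
    (hA : 𝒜.M.Super fun s => V (Sum.inl s)) (hB : ℬ.M.Super fun s => V (Sum.inr s))
    (hr : ∀ n (hn : n < 𝒜.Or.length), V (Sum.inr (ℬ.Ir[n]'(h₁ ▸ hn))) ≤ V (Sum.inl 𝒜.Or[n]))
    (hl : ∀ n (hn : n < ℬ.Ol.length), V (Sum.inl (𝒜.Il[n]'(h₂ ▸ hn))) ≤ V (Sum.inr ℬ.Ol[n])) :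
    (𝒜.seqComp ℬ h₁ h₂).M.Super V := by
  refine ⟨Sum.rec hA.1 hB.1, ?_⟩
  rintro (s | s) a
  · by_cases hs : s ∈ 𝒜.Or
    · obtain ⟨n, hn, rfl⟩ := List.mem_iff_getElem.1 hs
      rw [sum_prob_seqComp_Or hndA]
      exact hr n hn
    · cases a with
      | inl a =>
        rw [sum_prob_seqComp_inl hs]
        exact hA.2 s a
      | inr a => simpa [MDP.prob, seqComp_P_inl_inr hs] using hA.1 s
  · by_cases hs : s ∈ ℬ.Ol
    · obtain ⟨n, hn, rfl⟩ := List.mem_iff_getElem.1 hs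
      rw [sum_prob_seqComp_Ol hndB]
      exact hl n hn
    · cases a with
      | inr a =>
        rw [sum_prob_seqComp_inr hs]
        exact hB.2 s a
      | inl a => simpa [MDP.prob, seqComp_P_inr_inl hs] using hB.1 s

lemma super_seqComp_inl (hA : 𝒜.TerminalExits) {V : S₁ ⊕ S₂ → ℝ}
    (hV : (𝒜.seqComp ℬ h₁ h₂).M.Super V) : 𝒜.M.Super fun s => V (Sum.inl s) := by
  refine ⟨fun s => hV.1 _, fun s a => ?_⟩
  by_cases hs : s ∈ 𝒜.Or
  · simpa [hA.prob_eq_zero (List.mem_append_left _ hs)] using hV.1 _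
  · rw [← sum_prob_seqComp_inl (ℬ := ℬ) (h₁ := h₁) (h₂ := h₂) hs]
    exact hV.2 _ _

lemma super_seqComp_inr (hB : ℬ.TerminalExits) {V : S₁ ⊕ S₂ → ℝ}
    (hV : (𝒜.seqComp ℬ h₁ h₂).M.Super V) : ℬ.M.Super fun s => V (Sum.inr s) := by
  refine ⟨fun s => hV.1 _, fun s a => ?_⟩
  by_cases hs : s ∈ ℬ.Ol
  · simpa [hB.prob_eq_zero (List.mem_append_right _ hs)] using hV.1 _
  · rw [← sum_prob_seqComp_inr (𝒜 := 𝒜) (h₁ := h₁) (h₂ := h₂) hs]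
    exact hV.2 _ _

lemma super_seqComp_Or [Nonempty (A₁ ⊕ A₂)] (hnd : 𝒜.Or.Nodup) {V : S₁ ⊕ S₂ → ℝ}
    (hV : (𝒜.seqComp ℬ h₁ h₂).M.Super V) (n : ℕ) (hn : n < 𝒜.Or.length) :
    V (Sum.inr (ℬ.Ir[n]'(h₁ ▸ hn))) ≤ V (Sum.inl 𝒜.Or[n]) := by
  rw [← sum_prob_seqComp_Or (h₁ := h₁) (h₂ := h₂) hnd n hn (Classical.arbitrary _) V]
  exact hV.2 _ _

lemma super_seqComp_Ol [Nonempty (A₁ ⊕ A₂)] (hnd : ℬ.Ol.Nodup) {V : S₁ ⊕ S₂ → ℝ}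
    (hV : (𝒜.seqComp ℬ h₁ h₂).M.Super V) (n : ℕ) (hn : n < ℬ.Ol.length) :
    V (Sum.inl (𝒜.Il[n]'(h₂ ▸ hn))) ≤ V (Sum.inr ℬ.Ol[n]) := by
  rw [← sum_prob_seqComp_Ol (h₁ := h₁) (h₂ := h₂) hnd n hn (Classical.arbitrary _) V]
  exact hV.2 _ _

lemma terminalExits_seqComp (hA : 𝒜.TerminalExits) (hB : ℬ.TerminalExits)
    (hndA : 𝒜.exit.Nodup) (hndB : ℬ.exit.Nodup) :
    (𝒜.seqComp ℬ h₁ h₂).TerminalExits := by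
  have hdA := List.nodup_append'.1 hndA
  have hdB := List.nodup_append'.1 hndB
  constructor
  · rintro (s | s) a d hd
    · by_cases hs : s ∈ 𝒜.Or
      · obtain ⟨n, hn, rfl⟩ := List.mem_iff_getElem.1 hs
        rw [seqComp_P_Or hdA.1] at hd
        obtain rfl := Option.some.inj hd
        refine ⟨fun t => ?_, by simp⟩
        dsimp only
        split_ifs <;> norm_num
      · cases a with
        | inr a => simp [seqComp_P_inl_inr hs] at hd
        | inl a =>
          rw [seqComp_P_inl hs] at hd
          obtain ⟨e, he, rfl⟩ := Option.map_eq_some_iff.1 hd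
          obtain ⟨h0, h1⟩ := hA.1 s a e he
          exact ⟨Sum.rec h0 fun _ => le_rfl, by simpa using h1⟩
    · by_cases hs : s ∈ ℬ.Ol
      · obtain ⟨n, hn, rfl⟩ := List.mem_iff_getElem.1 hs
        rw [seqComp_P_Ol hdB.2.1] at hd
        obtain rfl := Option.some.inj hd
        refine ⟨fun t => ?_, by simp⟩
        dsimp only
        split_ifs <;> norm_num
      · cases a with
        | inl a => simp [seqComp_P_inr_inl hs] at hd
        | inr a =>
          rw [seqComp_P_inr hs] at hd
          obtain ⟨e, he, rfl⟩ := Option.map_eq_some_iff.1 hd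
          obtain ⟨h0, h1⟩ := hB.1 s a e he
          exact ⟨Sum.rec (fun _ => le_rfl) h0, by simpa using h1⟩
  · intro t ht a
    rcases List.mem_append.1 ht with h | h
    · obtain ⟨s, hs, rfl⟩ := List.mem_map.1 h
      have hs' : s ∉ ℬ.Ol := fun h' => hdB.2.2 hs h'
      cases a with
      | inl a => exact seqComp_P_inr_inl hs' a
      | inr a => rw [seqComp_P_inr hs', hB.2 s (List.mem_append_left _ hs) a]; rfl
    · obtain ⟨s, hs, rfl⟩ := List.mem_map.1 h
      have hs' : s ∉ 𝒜.Or := fun h' => hdA.2.2 h' hs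
      cases a with
      | inr a => exact seqComp_P_inl_inr hs' a
      | inl a => rw [seqComp_P_inl hs', hA.2 s (List.mem_append_right _ hs) a]; rfl

end seqComp

section shortcut

variable {S A : Type} [Fintype S] [Fintype A] {𝒜 : OMDP S A}

lemma WF.nodup_exit (h : 𝒜.WF) : 𝒜.exit.Nodup := by
  have h2 := h.2.1
  rw [List.append_assoc] at h2
  exact (List.nodup_append'.1 h2).2.1

lemma WF.not_mem_exit (h : 𝒜.WF) {s : S} (hs : s ∈ 𝒜.entr) : s ∉ 𝒜.exit := by
  have h2 := h.2.1
  rw [List.append_assoc] at h2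
  exact (List.nodup_append'.1 h2).2.2 hs

lemma WF.nodup_Or (h : 𝒜.WF) : 𝒜.Or.Nodup := (List.nodup_append'.1 h.nodup_exit).1

lemma WF.nodup_Ol (h : 𝒜.WF) : 𝒜.Ol.Nodup := (List.nodup_append'.1 h.nodup_exit).2.1

lemma WF.nonempty_action (h : 𝒜.WF) {s : S} (hs : s ∈ 𝒜.entr) : Nonempty A := by
  by_contra hA
  exact h.not_mem_exit hs ((h.2.2 s).2 fun a => (hA ⟨a⟩).elim)

variable {B : 𝒜.EntrIdx → Finset (𝒜.ExitIdx → ℝ)}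

lemma shortcut_P_some (k : 𝒜.EntrIdx) {a : ShortAct 𝒜 B} (ha : a.1 ∈ B k) :
    (𝒜.shortcut B).M.P (some k.1) a = some fun t' =>
      match t' with
      | none => 1 - ∑ j : 𝒜.ExitIdx, a.1 j
      | some s' => ∑ j : 𝒜.ExitIdx, if j.1 = s' then a.1 j else 0 := by
  have h : ∃ hs : k.1 ∈ 𝒜.entr, a.1 ∈ B ⟨k.1, hs⟩ := ⟨k.2, ha⟩
  simp only [shortcut]
  rw [dif_pos h]

lemma shortcut_P_none {s : S} {a : ShortAct 𝒜 B}
    (h : ¬ ∃ hs : s ∈ 𝒜.entr, a.1 ∈ B ⟨s, hs⟩) : (𝒜.shortcut B).M.P (some s) a = none := by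
  simp only [shortcut]
  rw [dif_neg h]

lemma sum_exit_mul (p : 𝒜.ExitIdx → ℝ) (V : S → ℝ) :
    ∑ s, (∑ j : 𝒜.ExitIdx, if j.1 = s then p j else 0) * V s = ∑ j : 𝒜.ExitIdx, p j * V j.1 := by
  simp only [Finset.sum_mul, ite_mul, zero_mul]
  rw [Finset.sum_comm]
  simp

lemma sum_prob_shortcut (k : 𝒜.EntrIdx) {a : ShortAct 𝒜 B} (ha : a.1 ∈ B k)
    (V : Option S → ℝ) :
    ∑ t, (𝒜.shortcut B).M.prob (some k.1) a t * V t =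
      (1 - ∑ j : 𝒜.ExitIdx, a.1 j) * V none + ∑ j : 𝒜.ExitIdx, a.1 j * V (some j.1) := by
  simp only [MDP.prob, shortcut_P_some k ha, Option.elim_some, Fintype.sum_option]
  rw [sum_exit_mul a.1 fun s => V (some s)]

lemma super_shortcut {V : Option S → ℝ} (hV : ∀ t, 0 ≤ V t) (hnone : V none = 0)
    (h : ∀ k, ∀ u ∈ B k, ∑ j : 𝒜.ExitIdx, u j * V (some j.1) ≤ V (some k.1)) :
    (𝒜.shortcut B).M.Super V := by
  refine ⟨hV, ?_⟩
  rintro (_ | s) a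
  · simpa [MDP.prob, shortcut] using hV none
  · by_cases hs : ∃ hs : s ∈ 𝒜.entr, a.1 ∈ B ⟨s, hs⟩
    · obtain ⟨hs, ha⟩ := hs
      rw [sum_prob_shortcut ⟨s, hs⟩ ha, hnone, mul_zero, zero_add]
      exact h ⟨s, hs⟩ _ ha
    · simpa [MDP.prob, shortcut_P_none hs] using hV (some s)

lemma sum_mul_le_of_super_shortcut {V : Option S → ℝ} (hV : (𝒜.shortcut B).M.Super V)
    (k : 𝒜.EntrIdx) {u : 𝒜.ExitIdx → ℝ} (hu : u ∈ B k) (hu1 : Subdist u) :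
    ∑ j : 𝒜.ExitIdx, u j * V (some j.1) ≤ V (some k.1) := by
  have h := hV.2 (some k.1) ⟨u, k, hu⟩
  rw [sum_prob_shortcut k hu] at h
  have := mul_nonneg (sub_nonneg.2 hu1.2) (hV.1 none)
  dsimp only at h
  linarith

lemma terminalExits_shortcut (h : 𝒜.WF) (hB : ∀ k, ∀ p ∈ B k, Subdist p) :
    (𝒜.shortcut B).TerminalExits := by
  constructor
  · rintro (_ | s) a d hd
    · simp [shortcut] at hd
    · by_cases hs : ∃ hs : s ∈ 𝒜.entr, a.1 ∈ B ⟨s, hs⟩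
      · obtain ⟨hs, ha⟩ := hs
        obtain ⟨h0, h1⟩ := hB _ _ ha
        rw [shortcut_P_some ⟨s, hs⟩ ha] at hd
        obtain rfl := Option.some.inj hd
        refine ⟨?_, ?_⟩
        · rintro (_ | t)
          · exact sub_nonneg.2 h1
          · refine Finset.sum_nonneg fun j _ => ?_
            split_ifs
            exacts [h0 j, le_rfl]
        · have := sum_exit_mul a.1 fun _ => 1
          simp only [mul_one] at this
          simp only [Fintype.sum_option, this]
          ring
      · simp [shortcut_P_none hs] at hd
  · intro t ht a
    obtain ⟨s, hs, rfl⟩ : ∃ s ∈ 𝒜.exit, some s = t := by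
      simpa [exit, shortcut, or_and_right, exists_or] using ht
    exact shortcut_P_none fun h' => h.not_mem_exit h'.1 hs

lemma nodup_exit_shortcut (h : 𝒜.WF) : (𝒜.shortcut B).exit.Nodup := by
  have : (𝒜.shortcut B).exit = 𝒜.exit.map some := by simp [exit, shortcut]
  rw [this]
  exact h.nodup_exit.map (Option.some_injective S)

/-- Upper bounds on the vertices of an upper approximation bound every achievable point. -/
lemma sum_mul_le_of_mem_dwConv {ι : Type} [Fintype ι] {B : Set (ι → ℝ)} {g : ι → ℝ}
    (hg : ∀ j, 0 ≤ g j) {c : ℝ} (h : ∀ u ∈ B, ∑ j, u j * g j ≤ c) {p : ι → ℝ}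
    (hp : p ∈ dwConv B) : ∑ j, p j * g j ≤ c := by
  obtain ⟨q, hq, hpq⟩ := hp
  have hsub : convexHull ℝ B ⊆ {u | ∑ j, u j * g j ≤ c} := by
    refine convexHull_min h ?_
    refine convex_halfSpace_le ⟨fun x y => ?_, fun r x => ?_⟩ c
    · simp [add_mul, Finset.sum_add_distrib]
    · simp [Finset.mul_sum, mul_assoc]
  exact (Finset.sum_le_sum fun j _ => mul_le_mul_of_nonneg_right (hpq j) (hg j)).trans (hsub hq)

lemma subset_dwConv {ι : Type} (X : Set (ι → ℝ)) : X ⊆ dwConv X := fun p hp =>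
  ⟨p, subset_convexHull ℝ X hp, le_rfl⟩

lemma achievable_nonempty (s : S) : (𝒜.achievable s).Nonempty :=
  ⟨_, 𝒜.M.policySched fun _ => none, MDP.isSched_policySched _, le_rfl⟩

/-- The least supersolution with prescribed exit values lies, at the entrances, below every
supersolution of the shortcut of an upper approximation. -/
lemma exists_super_le_shortcut (h : 𝒜.WF) (hB : ∀ k, ∀ p ∈ B k, Subdist p)
    (hupper : ∀ k : 𝒜.EntrIdx, 𝒜.achievable k.1 ⊆ dwConv (B k : Set (𝒜.ExitIdx → ℝ)))
    {V : Option S → ℝ} (hV : (𝒜.shortcut B).M.Super V) :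
    ∃ W : S → ℝ, 𝒜.M.Super W ∧ (∀ s ∈ 𝒜.exit, W s = V (some s)) ∧
      ∀ s ∈ 𝒜.entr, W s ≤ V (some s) := by
  obtain ⟨W, d, hW, hWe, hle⟩ :=
    exists_optimal h.terminalExits (g := fun s => V (some s)) fun s => hV.1 _
  refine ⟨W, hW, hWe, fun s hs => (hle s).trans ?_⟩
  exact sum_mul_le_of_mem_dwConv (fun j => hV.1 _)
    (fun u hu => sum_mul_le_of_super_shortcut hV ⟨s, hs⟩ hu (hB _ _ hu))
    (hupper ⟨s, hs⟩ ⟨_, MDP.isSched_policySched d, le_rfl⟩)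

/-- A supersolution extends to the shortcut of a lower approximation, with value 0 at the sink. -/
lemma super_shortcut_of_super (h : 𝒜.WF)
    (hlower : ∀ k : 𝒜.EntrIdx, dwConv (B k : Set (𝒜.ExitIdx → ℝ)) ⊆ 𝒜.achievable k.1)
    {V : S → ℝ} (hV : 𝒜.M.Super V) :
    (𝒜.shortcut B).M.Super fun t => t.elim 0 V := by
  refine super_shortcut ?_ rfl fun k u hu =>
    sum_mul_le_of_mem_achievable h.terminalExits (hlower k (subset_dwConv _ hu)) hV
  rintro (_ | s)
  exacts [le_rfl, hV.1 s]

lemma nonempty_shortAct {s : S} (hs : s ∈ 𝒜.entr)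
    (hupper : ∀ k : 𝒜.EntrIdx, 𝒜.achievable k.1 ⊆ dwConv (B k : Set (𝒜.ExitIdx → ℝ))) :
    Nonempty (ShortAct 𝒜 B) := by
  obtain ⟨p, hp⟩ := achievable_nonempty (𝒜 := 𝒜) s
  obtain ⟨q, hq, -⟩ := hupper ⟨s, hs⟩ hp
  obtain ⟨u, hu⟩ := convexHull_nonempty_iff.1 ⟨q, hq⟩
  exact ⟨⟨u, ⟨s, hs⟩, hu⟩⟩

end shortcut

end OMDP

end SD

namespace SD

namespace OMDP

variable {S₁ A₁ S₂ A₂ : Type} [Fintype S₁] [Fintype A₁] [Fintype S₂] [Fintype A₂]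
  {𝒜 : OMDP S₁ A₁} {ℬ : OMDP S₂ A₂} {h₁ : 𝒜.Or.length = ℬ.Ir.length}
  {h₂ : ℬ.Ol.length = 𝒜.Il.length} {BA : 𝒜.EntrIdx → Finset (𝒜.ExitIdx → ℝ)}
  {BB : ℬ.EntrIdx → Finset (ℬ.ExitIdx → ℝ)}
  {g₁ : (𝒜.shortcut BA).Or.length = (ℬ.shortcut BB).Ir.length}
  {g₂ : (ℬ.shortcut BB).Ol.length = (𝒜.shortcut BA).Il.length}

lemma shortcut_seqComp_exit : ((𝒜.shortcut BA).seqComp (ℬ.shortcut BB) g₁ g₂).exit =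
    (𝒜.seqComp ℬ h₁ h₂).exit.map (Sum.map some some) := by
  simp [exit, seqComp, shortcut, Function.comp_def]

/-- The identification of the exits of the composed shortcuts with those of the composition. -/
noncomputable def exitEquiv (hmem : ∀ s ∈ (𝒜.seqComp ℬ h₁ h₂).exit,
      Sum.map some some s ∈ ((𝒜.shortcut BA).seqComp (ℬ.shortcut BB) g₁ g₂).exit) :
    (𝒜.seqComp ℬ h₁ h₂).ExitIdx ≃
      ((𝒜.shortcut BA).seqComp (ℬ.shortcut BB) g₁ g₂).ExitIdx :=
  Equiv.ofBijective (fun j => ⟨Sum.map some some j.1, hmem j.1 j.2⟩) <| by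
    refine ⟨fun j k h => Subtype.ext ?_, fun k => ?_⟩
    · exact ((Option.some_injective S₁).sumMap (Option.some_injective S₂))
        (congrArg Subtype.val h)
    · obtain ⟨k, hk⟩ := k
      obtain ⟨s, hs, rfl⟩ := List.mem_map.1 (shortcut_seqComp_exit (h₁ := h₁) (h₂ := h₂) ▸ hk)
      exact ⟨⟨s, hs⟩, rfl⟩

lemma sum_exitEquiv (hmem : ∀ s ∈ (𝒜.seqComp ℬ h₁ h₂).exit,
      Sum.map some some s ∈ ((𝒜.shortcut BA).seqComp (ℬ.shortcut BB) g₁ g₂).exit)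
    (q : ((𝒜.shortcut BA).seqComp (ℬ.shortcut BB) g₁ g₂).ExitIdx → ℝ)
    (V : Option S₁ ⊕ Option S₂ → ℝ)
    {_ : Fintype ((𝒜.shortcut BA).seqComp (ℬ.shortcut BB) g₁ g₂).ExitIdx}
    {_ : Fintype (𝒜.seqComp ℬ h₁ h₂).ExitIdx} {f : (𝒜.seqComp ℬ h₁ h₂).ExitIdx → ℝ}
    (hf : ∀ j, f j = q (exitEquiv hmem j) * V (Sum.map some some j.1)) :
    ∑ j, f j = ∑ j, q j * V j.1 :=
  (Finset.sum_congr rfl fun j _ => hf j).trans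
    ((exitEquiv hmem).sum_comp fun j => q j * V j.1)

lemma mem_achievable_of_lower (hA : 𝒜.WF) (hB : ℬ.WF)
    (hBA : ∀ k, ∀ p ∈ BA k, Subdist p) (hBB : ∀ k, ∀ p ∈ BB k, Subdist p)
    (hlA : ∀ k : 𝒜.EntrIdx, dwConv (BA k : Set (𝒜.ExitIdx → ℝ)) ⊆ 𝒜.achievable k.1)
    (hlB : ∀ k : ℬ.EntrIdx, dwConv (BB k : Set (ℬ.ExitIdx → ℝ)) ⊆ ℬ.achievable k.1)
    (hmem : ∀ s ∈ (𝒜.seqComp ℬ h₁ h₂).exit,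
      Sum.map some some s ∈ ((𝒜.shortcut BA).seqComp (ℬ.shortcut BB) g₁ g₂).exit)
    (hne : Nonempty (A₁ ⊕ A₂)) {i : S₁ ⊕ S₂}
    {q : ((𝒜.shortcut BA).seqComp (ℬ.shortcut BB) g₁ g₂).ExitIdx → ℝ}
    (hq : q ∈ ((𝒜.shortcut BA).seqComp (ℬ.shortcut BB) g₁ g₂).achievable
      (Sum.map some some i)) :
    q ∘ exitEquiv hmem ∈ (𝒜.seqComp ℬ h₁ h₂).achievable i := by
  refine mem_achievable_of_forall_super (terminalExits_seqComp hA.terminalExits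
    hB.terminalExits hA.nodup_exit hB.nodup_exit) fun V hV => ?_
  let W : Option S₁ ⊕ Option S₂ → ℝ :=
    Sum.elim (fun t => t.elim 0 fun s => V (Sum.inl s)) fun t => t.elim 0 fun s => V (Sum.inr s)
  have hWV : ∀ t, W (Sum.map some some t) = V t := by rintro (s | s) <;> rfl
  have hW : ((𝒜.shortcut BA).seqComp (ℬ.shortcut BB) g₁ g₂).M.Super W := by
    refine super_seqComp (hA.nodup_Or.map (Option.some_injective S₁))
      (hB.nodup_Ol.map (Option.some_injective S₂))
      (super_shortcut_of_super hA hlA (super_seqComp_inl hA.terminalExits hV))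
      (super_shortcut_of_super hB hlB (super_seqComp_inr hB.terminalExits hV))
      (fun n hn => ?_) fun n hn => ?_
    · have hn' : n < 𝒜.Or.length := by simpa [shortcut] using hn
      simpa [W, shortcut] using super_seqComp_Or hA.nodup_Or hV n hn'
    · have hn' : n < ℬ.Ol.length := by simpa [shortcut] using hn
      simpa [W, shortcut] using super_seqComp_Ol hB.nodup_Ol hV n hn'
  have h := sum_mul_le_of_mem_achievable (terminalExits_seqComp (terminalExits_shortcut hA hBA)
    (terminalExits_shortcut hB hBB) (nodup_exit_shortcut hA) (nodup_exit_shortcut hB)) hq hW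
  rw [hWV] at h
  refine le_of_eq_of_le ?_ h
  exact sum_exitEquiv hmem q W fun j => by simp only [hWV, Function.comp_apply]

lemma mem_achievable_of_upper (hA : 𝒜.WF) (hB : ℬ.WF)
    (hBA : ∀ k, ∀ p ∈ BA k, Subdist p) (hBB : ∀ k, ∀ p ∈ BB k, Subdist p)
    (huA : ∀ k : 𝒜.EntrIdx, 𝒜.achievable k.1 ⊆ dwConv (BA k : Set (𝒜.ExitIdx → ℝ)))
    (huB : ∀ k : ℬ.EntrIdx, ℬ.achievable k.1 ⊆ dwConv (BB k : Set (ℬ.ExitIdx → ℝ)))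
    (hmem : ∀ s ∈ (𝒜.seqComp ℬ h₁ h₂).exit,
      Sum.map some some s ∈ ((𝒜.shortcut BA).seqComp (ℬ.shortcut BB) g₁ g₂).exit)
    (hne : Nonempty (ShortAct 𝒜 BA ⊕ ShortAct ℬ BB)) {i : S₁ ⊕ S₂}
    (hi : i ∈ (𝒜.seqComp ℬ h₁ h₂).entr) {p : (𝒜.seqComp ℬ h₁ h₂).ExitIdx → ℝ}
    (hp : p ∈ (𝒜.seqComp ℬ h₁ h₂).achievable i) :
    p ∘ (exitEquiv hmem).symm ∈ ((𝒜.shortcut BA).seqComp (ℬ.shortcut BB) g₁ g₂).achievable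
      (Sum.map some some i) := by
  have hTA := terminalExits_shortcut hA hBA
  have hTB := terminalExits_shortcut hB hBB
  refine mem_achievable_of_forall_super (terminalExits_seqComp hTA hTB
    (nodup_exit_shortcut hA) (nodup_exit_shortcut hB)) fun V hV => ?_
  obtain ⟨WA, hWA, hWAe, hWAi⟩ :=
    exists_super_le_shortcut hA hBA huA (super_seqComp_inl hTA hV)
  obtain ⟨WB, hWB, hWBe, hWBi⟩ :=
    exists_super_le_shortcut hB hBB huB (super_seqComp_inr hTB hV)
  have hW : (𝒜.seqComp ℬ h₁ h₂).M.Super (Sum.elim WA WB) := by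
    refine super_seqComp hA.nodup_Or hB.nodup_Ol hWA hWB (fun n hn => ?_) fun n hn => ?_
    · have hn' : n < (𝒜.shortcut BA).Or.length := by simpa [shortcut] using hn
      have h := super_seqComp_Or (hA.nodup_Or.map (Option.some_injective S₁)) hV n hn'
      have e := hWAe 𝒜.Or[n] (List.mem_append_left _ (List.getElem_mem hn))
      refine (hWBi _ (List.mem_append_left _ (List.getElem_mem _))).trans (le_trans ?_ e.ge)
      simpa [shortcut] using h
    · have hn' : n < (ℬ.shortcut BB).Ol.length := by simpa [shortcut] using hn
      have h := super_seqComp_Ol (hB.nodup_Ol.map (Option.some_injective S₂)) hV n hn'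
      have e := hWBe ℬ.Ol[n] (List.mem_append_right _ (List.getElem_mem hn))
      refine (hWAi _ (List.mem_append_right _ (List.getElem_mem _))).trans (le_trans ?_ e.ge)
      simpa [shortcut] using h
  have h := sum_mul_le_of_mem_achievable (terminalExits_seqComp hA.terminalExits
    hB.terminalExits hA.nodup_exit hB.nodup_exit) hp hW
  have he : ∀ j : (𝒜.seqComp ℬ h₁ h₂).ExitIdx,
      Sum.elim WA WB j.1 = V (Sum.map some some j.1) := by
    rintro ⟨t, ht⟩
    rcases List.mem_append.1 ht with ht | ht
    · obtain ⟨s, hs, rfl⟩ := List.mem_map.1 ht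
      exact hWBe s (List.mem_append_left _ hs)
    · obtain ⟨s, hs, rfl⟩ := List.mem_map.1 ht
      exact hWAe s (List.mem_append_right _ hs)
  simp only [he] at h
  refine le_of_eq_of_le ?_ (h.trans ?_)
  · exact Eq.symm (sum_exitEquiv hmem _ V fun j => by
      simp only [Function.comp_apply, Equiv.symm_apply_apply])
  rcases List.mem_append.1 hi with hi | hi
  · obtain ⟨s, hs, rfl⟩ := List.mem_map.1 hi
    exact hWAi s (List.mem_append_left _ hs)
  · obtain ⟨s, hs, rfl⟩ := List.mem_map.1 hi
    exact hWBi s (List.mem_append_right _ hs)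

lemma mem_entr_of_mem_entr_seqComp {i : S₁ ⊕ S₂} (hi : i ∈ (𝒜.seqComp ℬ h₁ h₂).entr) :
    (∃ s, s ∈ 𝒜.entr) ∨ ∃ s, s ∈ ℬ.entr := by
  rcases List.mem_append.1 hi with hi | hi
  · obtain ⟨s, hs, -⟩ := List.mem_map.1 hi
    exact .inl ⟨s, List.mem_append_left _ hs⟩
  · obtain ⟨s, hs, -⟩ := List.mem_map.1 hi
    exact .inr ⟨s, List.mem_append_right _ hs⟩

end OMDP

end SD

open SD in
/-- Let `𝒜`, `ℬ` be open MDPs whose sequential composition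
`𝒜 ⨟ ℬ` is well-defined (type-matching arities), and let `(L^𝒜,U^𝒜)` and
`(L^ℬ,U^ℬ)` be sound approximations of `𝒜` and `ℬ` (given by their vertex
families of subdistributions). Then the achievable sets of `D(L^𝒜) ⨟ D(L^ℬ)`
and of `D(U^𝒜) ⨟ D(U^ℬ)` form a sound approximation of `𝒜 ⨟ ℬ`: for every
entrance `i` of `𝒜 ⨟ ℬ`,
`A^{D(L^𝒜)⨟D(L^ℬ)}(i) ⊆ A^{𝒜⨟ℬ}(i) ⊆ A^{D(U^𝒜)⨟D(U^ℬ)}(i)`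
(the achievable sets of the composed shortcut oMDPs are transported along the
canonical identification `s ↦ Sum.map some some s` of the exits). -/
theorem statement_6 {S₁ A₁ S₂ A₂ : Type}
    [Fintype S₁] [Fintype A₁] [Fintype S₂] [Fintype A₂]
    (𝒜 : OMDP S₁ A₁) (ℬ : OMDP S₂ A₂) (hWFA : 𝒜.WF) (hWFB : ℬ.WF)
    (h₁ : 𝒜.Or.length = ℬ.Ir.length) (h₂ : ℬ.Ol.length = 𝒜.Il.length)
    (VLA VUA : 𝒜.EntrIdx → Finset (𝒜.ExitIdx → ℝ))
    (VLB VUB : ℬ.EntrIdx → Finset (ℬ.ExitIdx → ℝ))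
    (hVLA : ∀ k, ∀ p ∈ VLA k, Subdist p) (hVUA : ∀ k, ∀ p ∈ VUA k, Subdist p)
    (hVLB : ∀ k, ∀ p ∈ VLB k, Subdist p) (hVUB : ∀ k, ∀ p ∈ VUB k, Subdist p)
    (hsoundA : ∀ k : 𝒜.EntrIdx,
      dwConv ((VLA k : Finset (𝒜.ExitIdx → ℝ)) : Set (𝒜.ExitIdx → ℝ)) ⊆ 𝒜.achievable k.1 ∧
        𝒜.achievable k.1 ⊆ dwConv ((VUA k : Finset (𝒜.ExitIdx → ℝ)) : Set (𝒜.ExitIdx → ℝ)))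
    (hsoundB : ∀ k : ℬ.EntrIdx,
      dwConv ((VLB k : Finset (ℬ.ExitIdx → ℝ)) : Set (ℬ.ExitIdx → ℝ)) ⊆ ℬ.achievable k.1 ∧
        ℬ.achievable k.1 ⊆ dwConv ((VUB k : Finset (ℬ.ExitIdx → ℝ)) : Set (ℬ.ExitIdx → ℝ)))
    (gL₁ : (𝒜.shortcut VLA).Or.length = (ℬ.shortcut VLB).Ir.length)
    (gL₂ : (ℬ.shortcut VLB).Ol.length = (𝒜.shortcut VLA).Il.length)
    (gU₁ : (𝒜.shortcut VUA).Or.length = (ℬ.shortcut VUB).Ir.length)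
    (gU₂ : (ℬ.shortcut VUB).Ol.length = (𝒜.shortcut VUA).Il.length)
    (hmemL : ∀ s ∈ (𝒜.seqComp ℬ h₁ h₂).exit,
      Sum.map some some s ∈ ((𝒜.shortcut VLA).seqComp (ℬ.shortcut VLB) gL₁ gL₂).exit)
    (hmemU : ∀ s ∈ (𝒜.seqComp ℬ h₁ h₂).exit,
      Sum.map some some s ∈ ((𝒜.shortcut VUA).seqComp (ℬ.shortcut VUB) gU₁ gU₂).exit)
    (i : S₁ ⊕ S₂) (hi : i ∈ (𝒜.seqComp ℬ h₁ h₂).entr) :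
    pullExit (𝒜.seqComp ℬ h₁ h₂) ((𝒜.shortcut VLA).seqComp (ℬ.shortcut VLB) gL₁ gL₂)
        (Sum.map some some) hmemL ''
        ((𝒜.shortcut VLA).seqComp (ℬ.shortcut VLB) gL₁ gL₂).achievable (Sum.map some some i) ⊆
      (𝒜.seqComp ℬ h₁ h₂).achievable i ∧
    (𝒜.seqComp ℬ h₁ h₂).achievable i ⊆
      pullExit (𝒜.seqComp ℬ h₁ h₂) ((𝒜.shortcut VUA).seqComp (ℬ.shortcut VUB) gU₁ gU₂)
        (Sum.map some some) hmemU ''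
        ((𝒜.shortcut VUA).seqComp (ℬ.shortcut VUB) gU₁ gU₂).achievable (Sum.map some some i) := by
  have hent := OMDP.mem_entr_of_mem_entr_seqComp hi
  constructor
  · rintro _ ⟨q, hq, rfl⟩
    refine OMDP.mem_achievable_of_lower hWFA hWFB hVLA hVLB (fun k => (hsoundA k).1)
      (fun k => (hsoundB k).1) hmemL ?_ hq
    rcases hent with ⟨s, hs⟩ | ⟨s, hs⟩
    · exact (hWFA.nonempty_action hs).map Sum.inl
    · exact (hWFB.nonempty_action hs).map Sum.inr
  · intro p hp
    refine ⟨_, OMDP.mem_achievable_of_upper hWFA hWFB hVUA hVUB (fun k => (hsoundA k).2)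
      (fun k => (hsoundB k).2) hmemU ?_ hi hp, ?_⟩
    · rcases hent with ⟨s, hs⟩ | ⟨s, hs⟩
      · exact (OMDP.nonempty_shortAct hs fun k => (hsoundA k).2).map Sum.inl
      · exact (OMDP.nonempty_shortAct hs fun k => (hsoundB k).2).map Sum.inr
    · funext j
      exact congrArg p ((OMDP.exitEquiv hmemU).symm_apply_apply j)
end
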